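/- arXiv:math/0612220 — 7 statements merged into one kernel-verified Lean document; each statement's English description precedes it below -/
import Mathlib

section
/- Let f : [0,1] → ℝ be càdlàg. For λ ≥ 0 set f_λ(x) := f(x) − λx. Then the largest ascending barrier of f_λ converges to the largest positive jump of f as the drift is removed: lim_{λ→+∞} sup{ (f(y) − λy) − (f(x) − λx) : 0 ≤ x ≤ y ≤ 1 } = max(0, sup{ f(s) − f(s⁻) : 0 < s ≤ 1 }). -/
open Set Filter Topology

/-- Near each point of `[0,1]`, a càdlàg function is close to its value on the right and to its
left limit on the left. -/
theorem cadlag_local_approx {f fL : ℝ → ℝ}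
    (hrc : ∀ x ∈ Icc (0:ℝ) 1, Tendsto f (𝓝[Icc x 1] x) (𝓝 (f x)))
    (hll : ∀ s ∈ Ioc (0:ℝ) 1, Tendsto f (𝓝[Ico 0 s] s) (𝓝 (fL s)))
    {p : ℝ} (hp : p ∈ Icc (0:ℝ) 1) {ε : ℝ} (hε : 0 < ε) :
    ∃ δ > 0, ∀ x ∈ Icc (0:ℝ) 1, dist x p < δ →
      (p ≤ x → |f x - f p| < ε) ∧ (x < p → |f x - fL p| < ε) := by
  obtain ⟨δ₁, hδ₁, h₁⟩ := Metric.tendsto_nhdsWithin_nhds.1 (hrc p hp) ε hε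
  rcases hp.1.eq_or_lt with rfl | hp0
  · exact ⟨δ₁, hδ₁, fun x hx hd =>
      ⟨fun hpx => h₁ ⟨hpx, hx.2⟩ hd, fun hxp => absurd hxp hx.1.not_gt⟩⟩
  · obtain ⟨δ₂, hδ₂, h₂⟩ := Metric.tendsto_nhdsWithin_nhds.1 (hll p ⟨hp0, hp.2⟩) ε hε
    exact ⟨min δ₁ δ₂, lt_min hδ₁ hδ₂, fun x hx hd =>
      ⟨fun hpx => h₁ ⟨hpx, hx.2⟩ (hd.trans_le (min_le_left _ _)),
        fun hxp => h₂ ⟨hx.1, hxp⟩ (hd.trans_le (min_le_right _ _))⟩⟩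

/-- A càdlàg function on `[0,1]` is bounded. -/
theorem cadlag_bounded {f fL : ℝ → ℝ}
    (hrc : ∀ x ∈ Icc (0:ℝ) 1, Tendsto f (𝓝[Icc x 1] x) (𝓝 (f x)))
    (hll : ∀ s ∈ Ioc (0:ℝ) 1, Tendsto f (𝓝[Ico 0 s] s) (𝓝 (fL s))) :
    ∃ M : ℝ, ∀ x ∈ Icc (0:ℝ) 1, |f x| ≤ M := by
  refine isCompact_Icc.induction_on (p := fun s => ∃ M : ℝ, ∀ x ∈ s, |f x| ≤ M)
    ⟨0, by simp⟩ (fun s t hst ⟨M, hM⟩ => ⟨M, fun x hx => hM x (hst hx)⟩) ?_ ?_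
  · rintro s t ⟨M, hM⟩ ⟨N, hN⟩
    refine ⟨max M N, fun x hx => hx.elim (fun h => ?_) (fun h => ?_)⟩
    · exact (hM x h).trans (le_max_left _ _)
    · exact (hN x h).trans (le_max_right _ _)
  · intro p hp
    obtain ⟨δ, hδ, h⟩ := cadlag_local_approx hrc hll hp one_pos
    refine ⟨Icc 0 1 ∩ Metric.ball p δ,
      inter_mem self_mem_nhdsWithin (mem_nhdsWithin_of_mem_nhds (Metric.ball_mem_nhds p hδ)),
      max (|f p|) (|fL p|) + 1, fun x hx => ?_⟩
    obtain ⟨hr, hl⟩ := h x hx.1 hx.2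
    rcases le_or_gt p x with hpx | hxp
    · linarith [abs_sub_abs_le_abs_sub (f x) (f p), hr hpx, le_max_left (|f p|) (|fL p|)]
    · linarith [abs_sub_abs_le_abs_sub (f x) (fL p), hl hxp, le_max_right (|f p|) (|fL p|)]

/-- If the jumps of a càdlàg function on `[0,1]` are at most `J`, then its increments over short
intervals are at most `J + ε`. -/
theorem cadlag_increment_le {f fL : ℝ → ℝ}
    (hrc : ∀ x ∈ Icc (0:ℝ) 1, Tendsto f (𝓝[Icc x 1] x) (𝓝 (f x)))
    (hll : ∀ s ∈ Ioc (0:ℝ) 1, Tendsto f (𝓝[Ico 0 s] s) (𝓝 (fL s)))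
    {J : ℝ} (hJ0 : 0 ≤ J) (hJ : ∀ s ∈ Ioc (0:ℝ) 1, f s - fL s ≤ J) {ε : ℝ} (hε : 0 < ε) :
    ∃ δ > 0, ∀ x y : ℝ, 0 ≤ x → x ≤ y → y ≤ 1 → y - x < δ → f y - f x ≤ J + ε := by
  choose! r hr h using fun p (hp : p ∈ Icc (0:ℝ) 1) =>
    cadlag_local_approx hrc hll hp (half_pos hε)
  obtain ⟨δ, hδ, hcover⟩ := lebesgue_number_lemma_of_metric (isCompact_Icc (a := (0:ℝ)) (b := 1))
    (c := fun p : Icc (0:ℝ) 1 => Metric.ball (p : ℝ) (r p)) (fun _ => Metric.isOpen_ball)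
    (fun p hp => mem_iUnion.2 ⟨⟨p, hp⟩, Metric.mem_ball_self (hr p hp)⟩)
  refine ⟨δ, hδ, fun x y hx hxy hy hd => ?_⟩
  have hx1 : x ∈ Icc (0:ℝ) 1 := ⟨hx, hxy.trans hy⟩
  have hy1 : y ∈ Icc (0:ℝ) 1 := ⟨hx.trans hxy, hy⟩
  obtain ⟨⟨p, hp⟩, hball⟩ := hcover x hx1
  obtain ⟨hxr, hxl⟩ := h p hp x hx1 (hball (Metric.mem_ball_self hδ))
  obtain ⟨hyr, hyl⟩ := h p hp y hy1 (hball (by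
    rwa [Metric.mem_ball, Real.dist_eq, abs_of_nonneg (sub_nonneg.2 hxy)]))
  rcases le_or_gt p x with hpx | hxp
  · linarith [abs_lt.1 (hxr hpx), abs_lt.1 (hyr (hpx.trans hxy))]
  · rcases le_or_gt p y with hpy | hyp
    · linarith [abs_lt.1 (hxl hxp), abs_lt.1 (hyr hpy), hJ p ⟨hx.trans_lt hxp, hp.2⟩]
    · linarith [abs_lt.1 (hxl hxp), abs_lt.1 (hyl hyp)]

/-- Let `f : [0,1] → ℝ` be càdlàg (right-continuous within the interval
at each point, with left limit `fL s` at each `s ∈ (0,1]`).  For `λ ≥ 0` set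
`f_λ(x) := f(x) − λx`.  Then the largest ascending barrier of `f_λ` on `[0,1]` converges,
as `λ → +∞`, to the largest positive jump of `f` on `[0,1]`. -/
theorem drifted_barrier_tendsto_largest_jump
    (f fL : ℝ → ℝ)
    (hrc : ∀ x ∈ Icc (0:ℝ) 1, Tendsto f (𝓝[Icc x 1] x) (𝓝 (f x)))
    (hll : ∀ s ∈ Ioc (0:ℝ) 1, Tendsto f (𝓝[Ico 0 s] s) (𝓝 (fL s))) :
    Tendsto (fun lam : ℝ =>
        sSup {d : ℝ | ∃ x y : ℝ, 0 ≤ x ∧ x ≤ y ∧ y ≤ 1 ∧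
          d = (f y - lam * y) - (f x - lam * x)})
      atTop
      (𝓝 (max 0 (sSup {d : ℝ | ∃ s ∈ Ioc (0:ℝ) 1, d = f s - fL s}))) := by
  obtain ⟨M, hM⟩ := cadlag_bounded hrc hll
  have hne : ∀ s ∈ Ioc (0:ℝ) 1, (𝓝[Ico 0 s] s).NeBot := fun s hs =>
    mem_closure_iff_nhdsWithin_neBot.1 (by
      rw [closure_Ico hs.1.ne]
      exact right_mem_Icc.2 hs.1.le)
  have hfL : ∀ s ∈ Ioc (0:ℝ) 1, -M ≤ fL s := fun s hs => by
    have := hne s hs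
    refine ge_of_tendsto (hll s hs) ?_
    filter_upwards [self_mem_nhdsWithin] with x hx
    exact (abs_le.1 (hM x ⟨hx.1, hx.2.le.trans hs.2⟩)).1
  set S := {d : ℝ | ∃ s ∈ Ioc (0:ℝ) 1, d = f s - fL s}
  have hbddS : BddAbove S := by
    refine ⟨2 * M, ?_⟩
    rintro d ⟨s, hs, rfl⟩
    linarith [hfL s hs, (abs_le.1 (hM s ⟨hs.1.le, hs.2⟩)).2]
  have hJ : ∀ s ∈ Ioc (0:ℝ) 1, f s - fL s ≤ max 0 (sSup S) := fun s hs =>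
    (le_csSup hbddS ⟨s, hs, rfl⟩).trans (le_max_right _ _)
  have hJ0 : 0 ≤ max 0 (sSup S) := le_max_left _ _
  have hincr : ∀ x y : ℝ, 0 ≤ x → x ≤ y → y ≤ 1 → f y - f x ≤ 2 * M := fun x y hx hxy hy => by
    linarith [(abs_le.1 (hM x ⟨hx, hxy.trans hy⟩)).1, (abs_le.1 (hM y ⟨hx.trans hxy, hy⟩)).2]
  rw [Metric.tendsto_atTop']
  intro ε hε
  obtain ⟨δ, hδ, hshort⟩ := cadlag_increment_le hrc hll hJ0 hJ (half_pos hε)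
  refine ⟨max 0 (2 * M / δ), fun lam hlam => ?_⟩
  have hlam0 : 0 < lam := (le_max_left _ _).trans_lt hlam
  have hlamδ : 2 * M < lam * δ := (div_lt_iff₀ hδ).1 ((le_max_right _ _).trans_lt hlam)
  set B := {d : ℝ | ∃ x y : ℝ, 0 ≤ x ∧ x ≤ y ∧ y ≤ 1 ∧
    d = (f y - lam * y) - (f x - lam * x)}
  have hupper : ∀ d ∈ B, d ≤ max 0 (sSup S) + ε / 2 := by
    rintro d ⟨x, y, hx, hxy, hy, rfl⟩
    rcases lt_or_ge (y - x) δ with hd | hd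
    · linarith [hshort x y hx hxy hy hd, mul_le_mul_of_nonneg_left hxy hlam0.le]
    · linarith [hincr x y hx hxy hy, mul_le_mul_of_nonneg_left hd hlam0.le]
  have hbddB : BddAbove B := ⟨_, hupper⟩
  have h0B : (0 : ℝ) ∈ B := ⟨0, 0, le_rfl, le_rfl, zero_le_one, by ring⟩
  have hle : sSup B ≤ max 0 (sSup S) + ε / 2 := csSup_le ⟨0, h0B⟩ hupper
  have hge : max 0 (sSup S) ≤ sSup B := by
    refine max_le (le_csSup hbddB h0B) (csSup_le ⟨_, 1, by simp, rfl⟩ ?_)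
    rintro d ⟨s, hs, rfl⟩
    have := hne s hs
    have hid : Tendsto (fun x : ℝ => lam * x) (𝓝[Ico 0 s] s) (𝓝 (lam * s)) :=
      (continuous_const_mul lam).continuousWithinAt
    have hlim : Tendsto (fun x => (f s - lam * s) - (f x - lam * x)) (𝓝[Ico 0 s] s)
        (𝓝 (f s - fL s)) := by
      convert ((hll s hs).sub hid).const_sub (f s - lam * s) using 2
      ring
    refine le_of_tendsto hlim ?_
    filter_upwards [self_mem_nhdsWithin] with x hx
    exact le_csSup hbddB ⟨x, s, hx.1, hx.2.le, hs.2, rfl⟩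
  rw [Real.dist_eq, abs_of_nonneg (sub_nonneg.2 hge)]
  linarith
end

section
/- Let α ∈ (1,2) and δ > 0. Let (S_x)_{x≥0} be a real-valued stochastic process on a probability space such that S_0 = 0, almost every sample path is càdlàg, and S is self-similar with index 1/α: for every c > 0, the processes (S_{cx})_{x≥0} and (c^{1/α} S_x)_{x≥0} have the same finite-dimensional distributions. Set V_x := S_x − δx and V^#_r := sup{ V_y − V_x : 0 ≤ x ≤ y ≤ r }. Then V^#_r / r^{1/α} converges in distribution, as r → ∞, to the largest positive jump S^♮_1 := max(0, sup{ S_s − S_{s⁻} : 0 < s ≤ 1 }) of S on [0,1]. -/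
open Set Filter Topology MeasureTheory

/-- Near a point `s ≥ 0`, a càdlàg function is close to its value on the right and to its left
limit on the left. -/
theorem exists_pos_forall_near_of_cadlag {f L : ℝ → ℝ}
    (hR : ∀ x : ℝ, 0 ≤ x → Tendsto f (𝓝[≥] x) (𝓝 (f x)))
    (hL : ∀ s : ℝ, 0 < s → Tendsto f (𝓝[Ico 0 s] s) (𝓝 (L s)))
    {s ε : ℝ} (hs : 0 ≤ s) (hε : 0 < ε) :
    ∃ η > 0, (∀ u, s ≤ u → |u - s| < η → |f u - f s| < ε) ∧
      (∀ u, 0 ≤ u → u < s → |u - s| < η → |f u - L s| < ε) := by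
  obtain ⟨η₁, hη₁, h₁⟩ := Metric.tendsto_nhdsWithin_nhds.1 (hR s hs) ε hε
  have hr : ∀ u, s ≤ u → |u - s| < η₁ → |f u - f s| < ε := fun u hu hd => by
    simpa [Real.dist_eq] using h₁ hu (by simpa [Real.dist_eq] using hd)
  rcases hs.eq_or_lt with rfl | hs'
  · exact ⟨η₁, hη₁, hr, fun u hu hu' => absurd hu' hu.not_gt⟩
  · obtain ⟨η₂, hη₂, h₂⟩ := Metric.tendsto_nhdsWithin_nhds.1 (hL s hs') ε hε
    refine ⟨min η₁ η₂, lt_min hη₁ hη₂, fun u hu hd => hr u hu (hd.trans_le (min_le_left _ _)),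
      fun u hu hu' hd => ?_⟩
    simpa [Real.dist_eq] using h₂ ⟨hu, hu'⟩
      (by simpa [Real.dist_eq] using hd.trans_le (min_le_right _ _))

/-- A càdlàg function is bounded on compact intervals. -/
theorem exists_forall_abs_le_of_cadlag {f L : ℝ → ℝ}
    (hR : ∀ x : ℝ, 0 ≤ x → Tendsto f (𝓝[≥] x) (𝓝 (f x)))
    (hL : ∀ s : ℝ, 0 < s → Tendsto f (𝓝[Ico 0 s] s) (𝓝 (L s))) (T : ℝ) :
    ∃ K, ∀ x ∈ Icc (0 : ℝ) T, |f x| ≤ K := by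
  refine isCompact_Icc.induction_on (p := fun A => ∃ K, ∀ x ∈ A ∩ Icc (0 : ℝ) T, |f x| ≤ K)
    ⟨0, by simp⟩ (fun A B hAB ⟨K, hK⟩ => ⟨K, fun x hx => hK x ⟨hAB hx.1, hx.2⟩⟩) ?_ ?_
    |>.imp fun K hK x hx => hK x ⟨hx, hx⟩
  · rintro A B ⟨K, hK⟩ ⟨K', hK'⟩
    refine ⟨max K K', ?_⟩
    rintro x ⟨hx | hx, hxT⟩
    · exact (hK x ⟨hx, hxT⟩).trans (le_max_left _ _)
    · exact (hK' x ⟨hx, hxT⟩).trans (le_max_right _ _)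
  · intro s hs
    obtain ⟨η, hη, hr, hl⟩ := exists_pos_forall_near_of_cadlag hR hL hs.1 one_pos
    refine ⟨Metric.ball s η, mem_nhdsWithin_of_mem_nhds (Metric.ball_mem_nhds s hη),
      max |f s| |L s| + 1, ?_⟩
    rintro x ⟨hx, hxT⟩
    rw [Metric.mem_ball, Real.dist_eq] at hx
    rcases le_or_gt s x with h | h
    · have h1 := hr x h hx
      have h2 := abs_sub_abs_le_abs_sub (f x) (f s)
      have h3 := le_max_left |f s| |L s|
      linarith
    · have h1 := hl x hxT.1 h hx
      have h2 := abs_sub_abs_le_abs_sub (f x) (L s)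
      have h3 := le_max_right |f s| |L s|
      linarith

theorem nhdsWithin_Ico_left_neBot {s : ℝ} (hs : 0 < s) : (𝓝[Ico 0 s] s).NeBot := by
  rw [← mem_closure_iff_nhdsWithin_neBot, closure_Ico hs.ne]
  exact right_mem_Icc.2 hs.le

/-- The jumps of a càdlàg function on `(0, T]` are bounded. -/
theorem bddAbove_jumps_of_cadlag {f L : ℝ → ℝ}
    (hR : ∀ x : ℝ, 0 ≤ x → Tendsto f (𝓝[≥] x) (𝓝 (f x)))
    (hL : ∀ s : ℝ, 0 < s → Tendsto f (𝓝[Ico 0 s] s) (𝓝 (L s))) (T : ℝ) :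
    BddAbove {d : ℝ | ∃ s ∈ Ioc (0 : ℝ) T, d = f s - L s} := by
  obtain ⟨K, hK⟩ := exists_forall_abs_le_of_cadlag hR hL T
  refine ⟨K + K, ?_⟩
  rintro _ ⟨s, hs, rfl⟩
  have := nhdsWithin_Ico_left_neBot hs.1
  have h1 : -K ≤ L s := ge_of_tendsto (hL s hs.1) <| by
    filter_upwards [self_mem_nhdsWithin] with u hu
    exact (abs_le.1 (hK u ⟨hu.1, hu.2.le.trans hs.2⟩)).1
  have h2 := (abs_le.1 (hK s ⟨hs.1.le, hs.2⟩)).2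
  linarith

/-- Over short time intervals, a càdlàg function increases by little more than its largest
jump. -/
theorem exists_pos_forall_sub_le_of_cadlag {f L : ℝ → ℝ}
    (hR : ∀ x : ℝ, 0 ≤ x → Tendsto f (𝓝[≥] x) (𝓝 (f x)))
    (hL : ∀ s : ℝ, 0 < s → Tendsto f (𝓝[Ico 0 s] s) (𝓝 (L s)))
    {T J ε : ℝ} (hJ : 0 ≤ J) (hjump : ∀ s ∈ Ioc (0 : ℝ) T, f s - L s ≤ J) (hε : 0 < ε) :
    ∃ η > 0, ∀ x y, 0 ≤ x → x ≤ y → y ≤ T → y - x < η → f y - f x ≤ J + ε := by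
  have key : ∀ s : Icc (0 : ℝ) T, ∃ η > 0,
      (∀ u : ℝ, s.1 ≤ u → |u - s.1| < η → |f u - f s| < ε / 2) ∧
      (∀ u : ℝ, 0 ≤ u → u < s.1 → |u - s.1| < η → |f u - L s| < ε / 2) := fun s =>
    exists_pos_forall_near_of_cadlag hR hL s.2.1 (half_pos hε)
  choose η hη hr hl using key
  obtain ⟨θ, hθ, hball⟩ := lebesgue_number_lemma_of_metric (isCompact_Icc (a := (0 : ℝ)) (b := T))
    (c := fun s : Icc (0 : ℝ) T => Metric.ball s.1 (η s)) (fun _ => Metric.isOpen_ball)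
    (fun x hx => mem_iUnion.2 ⟨⟨x, hx⟩, Metric.mem_ball_self (hη _)⟩)
  refine ⟨θ, hθ, fun x y hx hxy hy hd => ?_⟩
  obtain ⟨s, hs⟩ := hball x ⟨hx, hxy.trans hy⟩
  have hxs : |x - s| < η s := by
    simpa [Real.dist_eq] using hs (Metric.mem_ball_self hθ)
  have hys : |y - s| < η s := by
    have : y ∈ Metric.ball x θ := by
      rw [Metric.mem_ball, Real.dist_eq, abs_of_nonneg (sub_nonneg.2 hxy)]; exact hd
    simpa [Real.dist_eq] using hs this
  rcases le_or_gt s.1 x with h | h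
  · have h1 := abs_lt.1 (hr s x h hxs)
    have h2 := abs_lt.1 (hr s y (h.trans hxy) hys)
    linarith [h1.1, h2.2]
  have h1 := abs_lt.1 (hl s x hx h hxs)
  rcases le_or_gt s.1 y with h' | h'
  · have h2 := abs_lt.1 (hr s y h' hys)
    have h3 := hjump s ⟨hx.trans_lt h, s.2.2⟩
    linarith [h1.1, h2.2]
  · have h2 := abs_lt.1 (hl s y (hx.trans hxy) h' hys)
    linarith [h1.1, h2.2]

/-- As the downward drift grows, the largest ascending barrier of a càdlàg function converges to
its largest positive jump. -/
theorem tendsto_barrier_of_cadlag {f L : ℝ → ℝ}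
    (hR : ∀ x : ℝ, 0 ≤ x → Tendsto f (𝓝[≥] x) (𝓝 (f x)))
    (hL : ∀ s : ℝ, 0 < s → Tendsto f (𝓝[Ico 0 s] s) (𝓝 (L s)))
    {B : ℝ → ℝ}
    (hB : ∀ c, IsLUB {d : ℝ | ∃ x y : ℝ, 0 ≤ x ∧ x ≤ y ∧ y ≤ 1 ∧
      d = (f y - c * y) - (f x - c * x)} (B c)) :
    Tendsto B atTop (𝓝 (max 0 (sSup {d : ℝ | ∃ s ∈ Ioc (0 : ℝ) 1, d = f s - L s}))) := by
  have hbdd := bddAbove_jumps_of_cadlag hR hL 1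
  set J := max 0 (sSup {d : ℝ | ∃ s ∈ Ioc (0 : ℝ) 1, d = f s - L s}) with hJdef
  have hJ : 0 ≤ J := le_max_left _ _
  have hjump : ∀ s ∈ Ioc (0 : ℝ) 1, f s - L s ≤ J := fun s hs =>
    (le_csSup hbdd ⟨s, hs, rfl⟩).trans (le_max_right _ _)
  obtain ⟨K, hK⟩ := exists_forall_abs_le_of_cadlag hR hL 1
  have hlower : ∀ c, J ≤ B c := by
    intro c
    refine max_le ((hB c).1 ⟨0, 0, le_rfl, le_rfl, zero_le_one, by ring⟩)
      (csSup_le ⟨_, 1, ⟨one_pos, le_rfl⟩, rfl⟩ ?_)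
    rintro _ ⟨s, hs, rfl⟩
    have := nhdsWithin_Ico_left_neBot hs.1
    have hid : Tendsto (fun u : ℝ => u) (𝓝[Ico 0 s] s) (𝓝 s) :=
      tendsto_id.mono_left nhdsWithin_le_nhds
    have ht : Tendsto (fun u => (f s - c * s) - (f u - c * u)) (𝓝[Ico 0 s] s)
        (𝓝 ((f s - c * s) - (L s - c * s))) :=
      tendsto_const_nhds.sub ((hL s hs.1).sub (hid.const_mul c))
    have := le_of_tendsto ht (b := B c) <| by
      filter_upwards [self_mem_nhdsWithin] with u hu
      exact (hB c).1 ⟨u, s, hu.1, hu.2.le, hs.2, rfl⟩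
    linarith
  refine tendsto_order.2 ⟨fun a ha => Eventually.of_forall fun c => ha.trans_le (hlower c),
    fun a ha => ?_⟩
  obtain ⟨η, hη, hinc⟩ := exists_pos_forall_sub_le_of_cadlag hR hL hJ hjump
    (half_pos (sub_pos.2 ha))
  filter_upwards [eventually_ge_atTop (2 * K / η), eventually_ge_atTop 0] with c hc hc0
  have : B c ≤ J + (a - J) / 2 := by
    refine (hB c).2 ?_
    rintro _ ⟨x, y, hx, hxy, hy, rfl⟩
    rcases lt_or_ge (y - x) η with h | h
    · have h1 := hinc x y hx hxy hy h
      have h2 := mul_nonneg hc0 (sub_nonneg.2 hxy)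
      linarith
    · have h1 := (abs_le.1 (hK x ⟨hx, hxy.trans hy⟩)).1
      have h2 := (abs_le.1 (hK y ⟨hx.trans hxy, hy⟩)).2
      have h3 : 2 * K ≤ c * η := (div_le_iff₀ hη).1 hc
      have h4 := mul_le_mul_of_nonneg_left h hc0
      linarith
  linarith

/-- The largest ascending barrier of a bounded function is the least upper bound of its
increments. -/
theorem isLUB_sSup_increments {f : ℝ → ℝ} {T K : ℝ} (hT : 0 ≤ T)
    (hK : ∀ x ∈ Icc (0 : ℝ) T, |f x| ≤ K) :
    IsLUB {d : ℝ | ∃ x y : ℝ, 0 ≤ x ∧ x ≤ y ∧ y ≤ T ∧ d = f y - f x}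
      (sSup {d : ℝ | ∃ x y : ℝ, 0 ≤ x ∧ x ≤ y ∧ y ≤ T ∧ d = f y - f x}) := by
  refine isLUB_csSup ⟨_, 0, 0, le_rfl, le_rfl, hT, rfl⟩ ⟨K + K, ?_⟩
  rintro _ ⟨x, y, hx, hxy, hy, rfl⟩
  have h1 := (abs_le.1 (hK x ⟨hx, hxy.trans hy⟩)).1
  have h2 := (abs_le.1 (hK y ⟨hx.trans hxy, hy⟩)).2
  linarith

theorem frequently_rat_nhdsGT (x : ℝ) : ∃ᶠ u in 𝓝[>] x, ∃ q : ℚ, (q : ℝ) = u := by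
  rw [frequently_iff]
  intro U hU
  obtain ⟨z, hz, hzU⟩ := (mem_nhdsGT_iff_exists_Ioo_subset).1 hU
  obtain ⟨q, hq₁, hq₂⟩ := exists_rat_btwn (mem_Ioi.1 hz)
  exact ⟨q, hzU ⟨hq₁, hq₂⟩, q, rfl⟩

/-- For right-continuous functions, increments between rational times control all increments. -/
theorem sub_le_of_forall_rat_sub_le {f : ℝ → ℝ} {A : ℝ}
    (hR : ∀ x ∈ Icc (0 : ℝ) 1, Tendsto f (𝓝[≥] x) (𝓝 (f x)))
    (hA : ∀ p q : ℚ, 0 ≤ p → p ≤ q → q ≤ 1 → f q - f p ≤ A)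
    {x y : ℝ} (hx : 0 ≤ x) (hxy : x ≤ y) (hy : y ≤ 1) : f y - f x ≤ A := by
  have hR' : ∀ x ∈ Icc (0 : ℝ) 1, Tendsto f (𝓝[>] x) (𝓝 (f x)) := fun x hx =>
    (hR x hx).mono_left (nhdsWithin_mono _ Ioi_subset_Ici_self)
  have hrat : ∀ (x : ℝ) (q : ℚ), 0 ≤ x → x < q → q ≤ 1 → f q - f x ≤ A := by
    intro x q hx hxq hq
    have hx1 : x ∈ Icc (0 : ℝ) 1 := ⟨hx, hxq.le.trans (by exact_mod_cast hq)⟩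
    refine le_of_tendsto_of_frequently (tendsto_const_nhds.sub (hR' x hx1)) ?_
    refine ((frequently_rat_nhdsGT x).and_eventually (Ioo_mem_nhdsGT hxq)).mono ?_
    rintro _ ⟨⟨p, rfl⟩, hp⟩
    exact hA p q (by exact_mod_cast hx.trans hp.1.le) (by exact_mod_cast hp.2.le) hq
  rcases hxy.eq_or_lt with rfl | hlt
  · simpa using hA 0 0 le_rfl le_rfl zero_le_one
  rcases hy.eq_or_lt with rfl | hy1
  · simpa using hrat x 1 hx (by simpa using hlt) le_rfl
  · refine le_of_tendsto_of_frequently ((hR' y ⟨hx.trans hxy, hy⟩).sub tendsto_const_nhds) ?_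
    refine ((frequently_rat_nhdsGT y).and_eventually (Ioo_mem_nhdsGT hy1)).mono ?_
    rintro _ ⟨⟨q, rfl⟩, hq⟩
    exact hrat x q hx (hlt.trans hq.1) (by exact_mod_cast hq.2.le)

/-- The largest ascending barrier of a right-continuous function is the limit of the maxima of
finitely many increments along an enumeration of the rational time pairs. -/
theorem tendsto_sup'_increments {f : ℝ → ℝ} {A : ℝ} {a b : ℕ → ℝ}
    (hab : ∀ n, 0 ≤ a n ∧ a n ≤ b n ∧ b n ≤ 1)
    (hsurj : ∀ p q : ℚ, 0 ≤ p → p ≤ q → q ≤ 1 → ∃ n, a n = p ∧ b n = q)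
    (hR : ∀ x ∈ Icc (0 : ℝ) 1, Tendsto f (𝓝[≥] x) (𝓝 (f x)))
    (hA : IsLUB {d : ℝ | ∃ x y : ℝ, 0 ≤ x ∧ x ≤ y ∧ y ≤ 1 ∧ d = f y - f x} A) :
    Tendsto (fun n : ℕ => (Finset.univ : Finset (Fin (n + 1))).sup' Finset.univ_nonempty
      (fun k => f (b k) - f (a k))) atTop (𝓝 A) := by
  refine tendsto_order.2 ⟨fun A' hA' => ?_, fun A' hA' => Eventually.of_forall fun n =>
    lt_of_le_of_lt (Finset.sup'_le _ _ fun k _ => hA.1 ⟨a k, b k, (hab k).1, (hab k).2.1,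
      (hab k).2.2, rfl⟩) hA'⟩
  have : ∃ p q : ℚ, 0 ≤ p ∧ p ≤ q ∧ q ≤ 1 ∧ A' < f q - f p := by
    by_contra! h
    refine hA'.not_ge (hA.2 ?_)
    rintro _ ⟨x, y, hx, hxy, hy, rfl⟩
    exact sub_le_of_forall_rat_sub_le hR h hx hxy hy
  obtain ⟨p, q, hp, hpq, hq, hlt⟩ := this
  obtain ⟨m, hm₁, hm₂⟩ := hsurj p q hp hpq hq
  filter_upwards [eventually_ge_atTop m] with n hn
  refine hlt.trans_le ?_
  rw [← hm₁, ← hm₂]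
  exact Finset.le_sup' (fun k : Fin (n + 1) => f (b k) - f (a k))
    (Finset.mem_univ (⟨m, by omega⟩ : Fin (n + 1)))

theorem exists_enum_rat_pairs : ∃ a b : ℕ → ℝ, (∀ n, 0 ≤ a n ∧ a n ≤ b n ∧ b n ≤ 1) ∧
    ∀ p q : ℚ, 0 ≤ p → p ≤ q → q ≤ 1 → ∃ n, a n = p ∧ b n = q := by
  have : Nonempty {p : ℚ × ℚ // 0 ≤ p.1 ∧ p.1 ≤ p.2 ∧ p.2 ≤ 1} :=
    ⟨⟨(0, 0), le_rfl, le_rfl, zero_le_one⟩⟩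
  obtain ⟨e, he⟩ := exists_surjective_nat {p : ℚ × ℚ // 0 ≤ p.1 ∧ p.1 ≤ p.2 ∧ p.2 ≤ 1}
  refine ⟨fun n => (e n).1.1, fun n => (e n).1.2, fun n => ?_, fun p q hp hpq hq => ?_⟩
  · obtain ⟨h₁, h₂, h₃⟩ := (e n).2
    exact ⟨Rat.cast_nonneg.2 h₁, Rat.cast_le.2 h₂, (Rat.cast_le.2 h₃).trans_eq Rat.cast_one⟩
  · obtain ⟨n, hn⟩ := he ⟨(p, q), hp, hpq, hq⟩
    exact ⟨n, by simp [hn], by simp [hn]⟩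

theorem measurable_sup'_increments {Ω : Type*} [MeasurableSpace Ω] {n : ℕ}
    {X Y : Fin (n + 1) → Ω → ℝ} (hX : ∀ k, Measurable (X k)) (hY : ∀ k, Measurable (Y k)) :
    Measurable fun ω => (Finset.univ : Finset (Fin (n + 1))).sup' Finset.univ_nonempty
      (fun k => Y k ω - X k ω) := by
  convert Finset.measurable_sup' (s := (Finset.univ : Finset (Fin (n + 1))))
    Finset.univ_nonempty (f := fun k ω => Y k ω - X k ω) (fun k _ => (hY k).sub (hX k)) using 1
  ext ω
  simp [Finset.sup'_apply]

/-- Let `α ∈ (1,2)`, `δ > 0`, and let `(S_x)_{x ≥ 0}` be a process with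
`S_0 = 0`, almost every path càdlàg (with left limits `SL`), which is self-similar with
index `1/α` in the sense of finite-dimensional distributions.  Set `V_x := S_x − δx` and
let `V^#_r` be the largest ascending barrier of `V` on `[0,r]`.  Then `V^#_r / r^{1/α}`
converges in distribution, as `r → ∞`, to the largest positive jump `S^♮_1` of `S` on
`[0,1]`.  Convergence in distribution is expressed by testing against every bounded
continuous function. -/
theorem drifted_stable_barrier_tendsto_largest_jump_in_law
    {Ω : Type*} [MeasurableSpace Ω] (P : Measure Ω) [IsProbabilityMeasure P]
    (α δ : ℝ) (hα₁ : 1 < α) (hα₂ : α < 2) (hδ : 0 < δ)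
    (S SL : ℝ → Ω → ℝ)
    (hmeas : ∀ x : ℝ, 0 ≤ x → Measurable (S x))
    (hpath : ∀ᵐ ω ∂P,
      S 0 ω = 0 ∧
      (∀ x : ℝ, 0 ≤ x → Tendsto (fun u => S u ω) (𝓝[≥] x) (𝓝 (S x ω))) ∧
      (∀ s : ℝ, 0 < s → Tendsto (fun u => S u ω) (𝓝[Ico 0 s] s) (𝓝 (SL s ω))))
    (hss : ∀ c : ℝ, 0 < c → ∀ n : ℕ, ∀ x : Fin n → ℝ, (∀ i, 0 ≤ x i) →
      Measure.map (fun ω => fun i => S (c * x i) ω) P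
        = Measure.map (fun ω => fun i => c ^ (1/α) * S (x i) ω) P)
    (V : ℝ → Ω → ℝ) (hV : ∀ x ω, V x ω = S x ω - δ * x)
    (Vsharp : ℝ → Ω → ℝ)
    (hVsharp : ∀ r ω, Vsharp r ω =
      sSup {d : ℝ | ∃ x y : ℝ, 0 ≤ x ∧ x ≤ y ∧ y ≤ r ∧ d = V y ω - V x ω})
    (Snat : Ω → ℝ)
    (hSnat : ∀ ω, Snat ω =
      max 0 (sSup {d : ℝ | ∃ s ∈ Ioc (0:ℝ) 1, d = S s ω - SL s ω})) :
    ∀ g : BoundedContinuousFunction ℝ ℝ,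
      Tendsto (fun r : ℝ => ∫ ω, g (Vsharp r ω / r ^ (1/α)) ∂P) atTop
        (𝓝 (∫ ω, g (Snat ω) ∂P)) := by
  obtain ⟨a, b, hab, hsurj⟩ := exists_enum_rat_pairs
  intro g
  set B : ℝ → Ω → ℝ := fun c ω =>
    sSup {d : ℝ | ∃ x y : ℝ, 0 ≤ x ∧ x ≤ y ∧ y ≤ 1 ∧ d = (S y ω - c * y) - (S x ω - c * x)}
    with hBdef
  set M : ℝ → ℕ → Ω → ℝ := fun c n ω =>
    (Finset.univ : Finset (Fin (n + 1))).sup' Finset.univ_nonempty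
      (fun k => (S (b k) ω - c * b k) - (S (a k) ω - c * a k)) with hMdef
  have hB : ∀ᵐ ω ∂P, ∀ c, IsLUB {d : ℝ | ∃ x y : ℝ, 0 ≤ x ∧ x ≤ y ∧ y ≤ 1 ∧
      d = (S y ω - c * y) - (S x ω - c * x)} (B c ω) := by
    filter_upwards [hpath] with ω ⟨_, hR, hL⟩ c
    obtain ⟨K, hK⟩ := exists_forall_abs_le_of_cadlag hR hL 1
    refine isLUB_sSup_increments (f := fun u => S u ω - c * u) (K := K + |c|) zero_le_one
      fun x hx => ?_
    refine (abs_sub _ _).trans (add_le_add (hK x hx) ?_)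
    rw [abs_mul, abs_of_nonneg hx.1]
    exact mul_le_of_le_one_right (abs_nonneg c) hx.2
  have hMB : ∀ c, ∀ᵐ ω ∂P, Tendsto (fun n => M c n ω) atTop (𝓝 (B c ω)) := by
    intro c
    filter_upwards [hpath, hB] with ω ⟨_, hR, _⟩ hBω
    exact tendsto_sup'_increments (f := fun u => S u ω - c * u) hab hsurj
      (fun x hx => (hR x hx.1).sub
        ((tendsto_id.mono_left nhdsWithin_le_nhds : Tendsto (fun u : ℝ => u) _ _).const_mul c))
      (hBω c)
  have hM : ∀ c n, Measurable (M c n) := by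
    intro c n
    exact measurable_sup'_increments (fun k => (hmeas _ (hab k).1).sub_const _)
      (fun k => (hmeas _ ((hab k).1.trans (hab k).2.1)).sub_const _)
  have hgM : ∀ c n, AEStronglyMeasurable (fun ω => g (M c n ω)) P := fun c n =>
    (g.continuous.measurable.comp (hM c n)).aestronglyMeasurable
  have hgMB : ∀ c, ∀ᵐ ω ∂P, Tendsto (fun n => g (M c n ω)) atTop (𝓝 (g (B c ω))) := fun c => by
    filter_upwards [hMB c] with ω hω
    exact (g.continuous.tendsto _).comp hω
  have hlim : Tendsto (fun c => ∫ ω, g (B c ω) ∂P) atTop (𝓝 (∫ ω, g (Snat ω) ∂P)) := by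
    refine tendsto_integral_filter_of_dominated_convergence (fun _ => ‖g‖)
      (Eventually.of_forall fun c => aestronglyMeasurable_of_tendsto_ae atTop (hgM c) (hgMB c))
      (Eventually.of_forall fun c => Eventually.of_forall fun ω => g.norm_coe_le_norm _)
      (integrable_const _) ?_
    filter_upwards [hpath, hB] with ω ⟨_, hR, hL⟩ hBω
    rw [hSnat]
    exact (g.continuous.tendsto _).comp (tendsto_barrier_of_cadlag hR hL hBω)
  have hexp : 0 < 1 - 1 / α := by
    rw [sub_pos, div_lt_one (by linarith)]
    exact hα₁
  refine (hlim.comp ((tendsto_rpow_atTop hexp).const_mul_atTop hδ)).congr' ?_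
  filter_upwards [eventually_gt_atTop 0] with r hr
  set c := δ * r ^ (1 - 1 / α) with hc
  set ρ := r ^ (1 / α) with hρdef
  have hρ : 0 < ρ := Real.rpow_pos_of_pos hr _
  have hcρ : c = δ * r / ρ := by
    rw [hc, Real.rpow_sub hr, Real.rpow_one, mul_div_assoc]
  set N : ℕ → Ω → ℝ := fun n ω =>
    (Finset.univ : Finset (Fin (n + 1))).sup' Finset.univ_nonempty
      (fun k => V (r * b k) ω / ρ - V (r * a k) ω / ρ) with hNdef
  have hNV : ∀ᵐ ω ∂P, Tendsto (fun n => N n ω) atTop (𝓝 (Vsharp r ω / ρ)) := by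
    filter_upwards [hpath] with ω ⟨_, hR, hL⟩
    obtain ⟨K, hK⟩ := exists_forall_abs_le_of_cadlag hR hL r
    have hlub := isLUB_sSup_increments (f := fun u => V u ω) (T := r) (K := K + δ * r) hr.le
      fun x hx => by
        rw [hV]
        refine (abs_sub _ _).trans (add_le_add (hK x hx) ?_)
        rw [abs_of_nonneg (mul_nonneg hδ.le hx.1)]
        exact mul_le_mul_of_nonneg_left hx.2 hδ.le
    rw [← hVsharp] at hlub
    refine tendsto_sup'_increments (f := fun u => V (r * u) ω / ρ) hab hsurj ?_ ⟨?_, ?_⟩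
    · intro x hx
      have hmul : Tendsto (fun u : ℝ => r * u) (𝓝[≥] x) (𝓝[≥] (r * x)) := by
        refine tendsto_nhdsWithin_iff.2 ⟨?_, ?_⟩
        · exact ((continuous_const.mul continuous_id).tendsto x).mono_left nhdsWithin_le_nhds
        · filter_upwards [self_mem_nhdsWithin] with u hu
          exact mul_le_mul_of_nonneg_left hu hr.le
      have hVR : Tendsto (fun u => V u ω) (𝓝[≥] (r * x)) (𝓝 (V (r * x) ω)) := by
        simp only [hV]
        exact (hR _ (mul_nonneg hr.le hx.1)).sub
          ((tendsto_id.mono_left nhdsWithin_le_nhds : Tendsto (fun u : ℝ => u) _ _).const_mul δ)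
      exact (hVR.comp hmul).div_const ρ
    · rintro _ ⟨x, y, hx, hxy, hy, rfl⟩
      rw [← sub_div]
      refine div_le_div_of_nonneg_right (hlub.1 ⟨r * x, r * y, mul_nonneg hr.le hx,
        mul_le_mul_of_nonneg_left hxy hr.le, ?_, rfl⟩) hρ.le
      simpa using mul_le_mul_of_nonneg_left hy hr.le
    · intro A hA
      rw [div_le_iff₀ hρ]
      refine hlub.2 ?_
      rintro _ ⟨x, y, hx, hxy, hy, rfl⟩
      rw [← div_le_iff₀ hρ, sub_div]
      refine hA ⟨x / r, y / r, by positivity, by gcongr, (div_le_one hr).2 hy, ?_⟩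
      simp only [mul_div_cancel₀ _ hr.ne']
  have hlaw : ∀ n, ∫ ω, g (N n ω) ∂P = ∫ ω, g (M c n ω) ∂P := by
    intro n
    set G : (Fin (n + 1 + (n + 1)) → ℝ) → ℝ := fun v =>
      g ((Finset.univ : Finset (Fin (n + 1))).sup' Finset.univ_nonempty
        (fun k => (v (Fin.natAdd (n + 1) k) / ρ - c * b k)
          - (v (Fin.castAdd (n + 1) k) / ρ - c * a k))) with hGdef
    have hG : Measurable G := by
      refine g.continuous.measurable.comp ?_
      exact measurable_sup'_increments (fun k => by fun_prop) (fun k => by fun_prop)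
    set x : Fin (n + 1 + (n + 1)) → ℝ :=
      Fin.append (fun k : Fin (n + 1) => a k) (fun k : Fin (n + 1) => b k) with hxdef
    have hx : ∀ i, 0 ≤ x i := by
      intro i
      refine Fin.addCases (fun k => ?_) (fun k => ?_) i
      · rw [hxdef, Fin.append_left]
        exact (hab k).1
      · rw [hxdef, Fin.append_right]
        exact (hab k).1.trans (hab k).2.1
    have hmap := congrArg (fun μ => ∫ v, G v ∂μ) (hss r hr _ x hx)
    rw [integral_map (measurable_pi_lambda _ fun i => hmeas _
        (mul_nonneg hr.le (hx i))).aemeasurable hG.aestronglyMeasurable,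
      integral_map (measurable_pi_lambda _ fun i => (hmeas _ (hx i)).const_mul _).aemeasurable
        hG.aestronglyMeasurable] at hmap
    convert hmap using 3 with ω ω
    · simp only [hGdef, hNdef, hxdef, Fin.append_left, Fin.append_right, hV, hcρ]
      congr! 3 with k <;> field_simp
    · simp only [hGdef, hMdef, hxdef, Fin.append_left, Fin.append_right]
      congr! 3 with k <;> rw [mul_div_cancel_left₀ _ hρ.ne']
  have hgN : ∀ n, AEStronglyMeasurable (fun ω => g (N n ω)) P := by
    have hVmeas : ∀ u, 0 ≤ u → Measurable (V u) := fun u hu => by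
      rw [show V u = fun ω => S u ω - δ * u from funext (hV u)]
      exact (hmeas u hu).sub_const _
    exact fun n => (g.continuous.measurable.comp (measurable_sup'_increments
      (fun k => (hVmeas _ (mul_nonneg hr.le (hab k).1)).div_const _)
      (fun k => (hVmeas _ (mul_nonneg hr.le
        ((hab k).1.trans (hab k).2.1))).div_const _))).aestronglyMeasurable
  have h₁ : Tendsto (fun n => ∫ ω, g (N n ω) ∂P) atTop (𝓝 (∫ ω, g (Vsharp r ω / ρ) ∂P)) :=
    tendsto_integral_of_dominated_convergence (fun _ => ‖g‖) hgN (integrable_const _)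
      (fun n => Eventually.of_forall fun ω => g.norm_coe_le_norm _)
      (hNV.mono fun ω hω => (g.continuous.tendsto _).comp hω)
  have h₂ : Tendsto (fun n => ∫ ω, g (M c n ω) ∂P) atTop (𝓝 (∫ ω, g (B c ω) ∂P)) :=
    tendsto_integral_of_dominated_convergence (fun _ => ‖g‖) (hgM c) (integrable_const _)
      (fun n => Eventually.of_forall fun ω => g.norm_coe_le_norm _) (hgMB c)
  simp only [hlaw] at h₁
  exact tendsto_nhds_unique h₂ h₁
end

section
/- Let α > 0 and s > 0, and let h : [0,∞) → (0,∞) be nondecreasing with (log h(r))/r^{1/α} → s as r → ∞. Then h(r) → ∞, so m(t) := sup{ r ≥ 0 : h(r) ≤ t } (with sup ∅ := 0) is finite for every t, and m(t)/(log t)^α → s^{−α} as t → ∞. -/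
open Set Filter Topology

/-- Along the scale `b * (log t) ^ α`, the function `log h` grows like `s * b ^ (1/α) * log t`. -/
theorem tendsto_log_comp_mul_log_rpow_div_log {α s b : ℝ} (hα : 0 < α) (hb : 0 < b) {h : ℝ → ℝ}
    (hlim : Tendsto (fun r : ℝ => Real.log (h r) / r ^ (1/α)) atTop (𝓝 s)) :
    Tendsto (fun t : ℝ => Real.log (h (b * Real.log t ^ α)) / Real.log t) atTop
      (𝓝 (s * b ^ (1/α))) := by
  have hscale : Tendsto (fun t : ℝ => b * Real.log t ^ α) atTop atTop :=
    ((tendsto_rpow_atTop hα).comp Real.tendsto_log_atTop).const_mul_atTop hb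
  refine ((hlim.comp hscale).mul_const (b ^ (1/α))).congr' ?_
  filter_upwards [eventually_gt_atTop 1] with t ht
  have hL : 0 < Real.log t := Real.log_pos ht
  have hpow : (b * Real.log t ^ α) ^ (1/α) = b ^ (1/α) * Real.log t := by
    rw [Real.mul_rpow hb.le (by positivity), ← Real.rpow_mul hL.le, mul_one_div_cancel hα.ne',
      Real.rpow_one]
  have hbpow : 0 < b ^ (1/α) := by positivity
  simp only [Function.comp_apply, hpow]
  field_simp

/-- A function whose logarithm grows like a power tends to infinity. -/
theorem tendsto_atTop_of_log_div_rpow {α s : ℝ} (hα : 0 < α) (hs : 0 < s) {h : ℝ → ℝ}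
    (hpos : ∀ r : ℝ, 0 ≤ r → 0 < h r)
    (hlim : Tendsto (fun r : ℝ => Real.log (h r) / r ^ (1/α)) atTop (𝓝 s)) :
    Tendsto h atTop atTop := by
  have hlog : Tendsto (fun r : ℝ => Real.log (h r)) atTop atTop := by
    refine (hlim.pos_mul_atTop hs (tendsto_rpow_atTop (one_div_pos.2 hα))).congr' ?_
    filter_upwards [eventually_gt_atTop 0] with r hr
    exact div_mul_cancel₀ _ (Real.rpow_pos_of_pos hr _).ne'
  refine (Real.tendsto_exp_atTop.comp hlog).congr' ?_
  filter_upwards [eventually_ge_atTop 0] with r hr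
  exact Real.exp_log (hpos r hr)

/-- The sublevel sets of a function tending to infinity at infinity are bounded above. -/
theorem bddAbove_sublevel_of_tendsto_atTop {h : ℝ → ℝ} (hinf : Tendsto h atTop atTop) (t : ℝ) :
    BddAbove {r : ℝ | 0 ≤ r ∧ h r ≤ t} := by
  obtain ⟨R, hR⟩ := eventually_atTop.1 (hinf.eventually_gt_atTop t)
  exact ⟨R, fun r hr => le_of_not_ge fun hle => (hR r hle).not_ge hr.2⟩

/-- Let `α > 0`, `s > 0` and let `h : [0,∞) → (0,∞)` be nondecreasing
with `(log h(r))/r^{1/α} → s` as `r → ∞`.  Then `h(r) → ∞`, the generalized inverse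
`m(t) := sup{ r ≥ 0 : h(r) ≤ t }` (with `sup ∅ := 0`, which is the convention for `sSup`
on `ℝ`) is finite (the set is bounded above) for every `t`, and
`m(t)/(log t)^α → s^{−α}` as `t → ∞`. -/
theorem generalized_inverse_asymptotics
    (α s : ℝ) (hα : 0 < α) (hs : 0 < s)
    (h : ℝ → ℝ)
    (hpos : ∀ r : ℝ, 0 ≤ r → 0 < h r)
    (hmono : MonotoneOn h (Ici (0:ℝ)))
    (hlim : Tendsto (fun r : ℝ => Real.log (h r) / r ^ (1/α)) atTop (𝓝 s)) :
    Tendsto h atTop atTop ∧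
    (∀ t : ℝ, BddAbove {r : ℝ | 0 ≤ r ∧ h r ≤ t}) ∧
    Tendsto (fun t : ℝ => sSup {r : ℝ | 0 ≤ r ∧ h r ≤ t} / Real.log t ^ α) atTop
      (𝓝 (s ^ (-α))) := by
  have hinf := tendsto_atTop_of_log_div_rpow hα hs hpos hlim
  have hbdd := bddAbove_sublevel_of_tendsto_atTop hinf
  have hroot : (s ^ (-α)) ^ (1/α) = s⁻¹ := by
    rw [← Real.rpow_mul hs.le, neg_mul, mul_one_div_cancel hα.ne', Real.rpow_neg_one]
  have hcrit : 0 < s ^ (-α) := Real.rpow_pos_of_pos hs _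
  refine ⟨hinf, hbdd, tendsto_order.2 ⟨fun a ha => ?_, fun a ha => ?_⟩⟩
  · obtain ⟨b, hab, hbs⟩ := exists_between (max_lt ha hcrit)
    have hb : 0 < b := (le_max_right _ _).trans_lt hab
    have hlt : s * b ^ (1/α) < 1 := by
      calc s * b ^ (1/α) < s * (s ^ (-α)) ^ (1/α) := by gcongr
        _ = 1 := by rw [hroot, mul_inv_cancel₀ hs.ne']
    filter_upwards [(tendsto_log_comp_mul_log_rpow_div_log hα hb hlim).eventually_lt_const hlt,
      eventually_gt_atTop 1] with t hlog ht
    have hL : 0 < Real.log t := Real.log_pos ht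
    have hr : 0 ≤ b * Real.log t ^ α := by positivity
    rw [div_lt_one hL, Real.log_lt_log_iff (hpos _ hr) (by linarith)] at hlog
    exact ((le_max_left _ _).trans_lt hab).trans_le
      ((le_div_iff₀ (by positivity)).2 (le_csSup (hbdd t) ⟨hr, hlog.le⟩))
  · obtain ⟨b, hsb, hba⟩ := exists_between ha
    have hb : 0 < b := hcrit.trans hsb
    have hlt : 1 < s * b ^ (1/α) := by
      calc 1 = s * (s ^ (-α)) ^ (1/α) := by rw [hroot, mul_inv_cancel₀ hs.ne']
        _ < s * b ^ (1/α) := by gcongr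
    filter_upwards [(tendsto_log_comp_mul_log_rpow_div_log hα hb hlim).eventually_const_lt hlt,
      eventually_gt_atTop 1] with t hlog ht
    have hL : 0 < Real.log t := Real.log_pos ht
    have hr : 0 ≤ b * Real.log t ^ α := by positivity
    rw [one_lt_div hL, Real.log_lt_log_iff (by linarith) (hpos _ hr)] at hlog
    refine lt_of_le_of_lt ((div_le_iff₀ (by positivity)).2 (Real.sSup_le (fun r hrt => ?_) hr)) hba
    exact le_of_not_ge fun hle => (hlog.trans_le (hmono hr hrt.1 hle)).not_ge hrt.2
end

section
/- Let α > 0, let (Ω, P) be a probability space, and let H : [0,∞) × Ω → (0,∞) be such that r ↦ H_r(ω) is nondecreasing for every ω, each H_r is a random variable, and for each t ≥ 0 the variable M_t := sup{ r ≥ 0 : H_r ≤ t } (with sup ∅ := 0) is measurable and almost surely finite. Suppose that (log H_r)/r^{1/α} converges in distribution, as r → ∞, to a random variable S with S > 0 almost surely. Then M_t/(log t)^α converges in distribution, as t → ∞, to S^{−α}. -/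
open Set Filter Topology MeasureTheory

/-- Convergence of the distribution functions on a dense set of points implies weak convergence. -/
theorem tendsto_probabilityMeasure_of_tendsto_Iic {ι : Type*} {l : Filter ι}
    [l.IsCountablyGenerated] {μ : ι → ProbabilityMeasure ℝ} {ν : ProbabilityMeasure ℝ}
    {D : Set ℝ} (hD : Dense D)
    (h : ∀ x ∈ D, Tendsto (fun i => (μ i : Measure ℝ).real (Iic x)) l
      (𝓝 ((ν : Measure ℝ).real (Iic x)))) :
    Tendsto μ l (𝓝 ν) := by
  have hpi : IsPiSystem {s : Set ℝ | ∃ a ∈ D, ∃ b ∈ D, a ≤ b ∧ Ioc a b = s} := by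
    rintro _ ⟨a, ha, b, hb, -, rfl⟩ _ ⟨a', ha', b', hb', -, rfl⟩ hne
    rw [Ioc_inter_Ioc] at hne ⊢
    refine ⟨a ⊔ a', ?_, b ⊓ b', ?_, ?_, rfl⟩
    · rcases max_choice a a' with e | e <;> rw [e] <;> assumption
    · rcases min_choice b b' with e | e <;> rw [e] <;> assumption
    · obtain ⟨y, hy⟩ := hne
      exact (hy.1.trans_le hy.2).le
  refine hpi.tendsto_probabilityMeasure_of_tendsto_of_mem ?_ ?_ ?_
  · rintro _ ⟨a, -, b, -, -, rfl⟩
    exact measurableSet_Ioc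
  · intro u hu x hx
    obtain ⟨p, q, hxpq, hpq⟩ := mem_nhds_iff_exists_Ioo_subset.1 (hu.mem_nhds hx)
    obtain ⟨a, haD, ha⟩ := hD.exists_between hxpq.1
    obtain ⟨b, hbD, hb⟩ := hD.exists_between hxpq.2
    exact ⟨Ioc a b, ⟨a, haD, b, hbD, (ha.2.trans hb.1).le, rfl⟩, Ioc_mem_nhds ha.2 hb.1,
      (Ioc_subset_Ioo_right hb.2).trans ((Ioo_subset_Ioo_left ha.1.le).trans hpq)⟩
  · rintro _ ⟨a, ha, b, hb, hab, rfl⟩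
    have key (m : ProbabilityMeasure ℝ) :
        ((m (Ioc a b) : NNReal) : ℝ) =
          (m : Measure ℝ).real (Iic b) - (m : Measure ℝ).real (Iic a) := by
      rw [← measureReal_sdiff (Iic_subset_Iic.2 hab) measurableSet_Iic]
      have : Iic b \ Iic a = Ioc a b := by ext y; simp [and_comm]
      rw [this]
      rfl
    rw [← NNReal.tendsto_coe]
    simp only [key]
    exact (h b hb).sub (h a ha)

/-- The law of a real random variable, as a bundled probability measure. -/
noncomputable def law {Ω : Type*} [MeasurableSpace Ω] (P : Measure Ω) [IsProbabilityMeasure P]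
    {X : Ω → ℝ} (hX : Measurable X) : ProbabilityMeasure ℝ :=
  ⟨P.map X, Measure.isProbabilityMeasure_map hX.aemeasurable⟩

theorem toMeasure_law {Ω : Type*} [MeasurableSpace Ω] (P : Measure Ω) [IsProbabilityMeasure P]
    {X : Ω → ℝ} (hX : Measurable X) : (law P hX : Measure ℝ) = P.map X := rfl

/-- Convergence in distribution, in terms of expectations, is weak convergence of the laws. -/
theorem tendsto_law_iff_forall_integral {Ω ι : Type*} [MeasurableSpace Ω] {P : Measure Ω}
    [IsProbabilityMeasure P] {l : Filter ι} {X : ι → Ω → ℝ} {Y : Ω → ℝ}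
    (hX : ∀ i, Measurable (X i)) (hY : Measurable Y) :
    Tendsto (fun i => law P (hX i)) l (𝓝 (law P hY)) ↔
    ∀ g : BoundedContinuousFunction ℝ ℝ,
      Tendsto (fun i => ∫ ω, g (X i ω) ∂P) l (𝓝 (∫ ω, g (Y ω) ∂P)) := by
  rw [ProbabilityMeasure.tendsto_iff_forall_integral_tendsto]
  refine forall_congr' fun g => ?_
  have key {Z : Ω → ℝ} (hZ : Measurable Z) :
      ∫ x, g x ∂(law P hZ : Measure ℝ) = ∫ ω, g (Z ω) ∂P :=
    integral_map hZ.aemeasurable g.continuous.aestronglyMeasurable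
  simp only [key]

/-- Convergence in distribution implies convergence of the upper tails at every point that the
limit avoids almost surely. -/
theorem tendsto_measureReal_lt_of_forall_integral {Ω ι : Type*} [MeasurableSpace Ω]
    {P : Measure Ω} [IsProbabilityMeasure P] {l : Filter ι} {X : ι → Ω → ℝ} {Y : Ω → ℝ}
    (hX : ∀ i, Measurable (X i)) (hY : Measurable Y)
    (h : ∀ g : BoundedContinuousFunction ℝ ℝ,
      Tendsto (fun i => ∫ ω, g (X i ω) ∂P) l (𝓝 (∫ ω, g (Y ω) ∂P)))
    {c : ℝ} (hc : P {ω | Y ω = c} = 0) :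
    Tendsto (fun i => P.real {ω | c < X i ω}) l (𝓝 (P.real {ω | c < Y ω})) := by
  have hw := (tendsto_law_iff_forall_integral hX hY).2 h
  have hfr : (law P hY : Measure ℝ) (frontier (Ioi c)) = 0 := by
    rw [toMeasure_law, frontier_Ioi, Measure.map_apply hY (measurableSet_singleton c)]
    exact hc
  have hlim := ProbabilityMeasure.tendsto_measure_of_null_frontier_of_tendsto' hw hfr
  have key {Z : Ω → ℝ} (hZ : Measurable Z) :
      (law P hZ : Measure ℝ) (Ioi c) = P {ω | c < Z ω} :=
    Measure.map_apply hZ measurableSet_Ioi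
  simp only [key] at hlim
  exact (ENNReal.tendsto_toReal (measure_ne_top _ _)).comp hlim

theorem rpow_neg_one_div_lt_log_div_iff {α x t h : ℝ} (hα : 0 < α) (hx : 0 < x) (ht : 1 < t)
    (hh : 0 < h) :
    x ^ (-(1 / α)) < Real.log h / (x * Real.log t ^ α) ^ (1 / α) ↔ t < h := by
  have hL : 0 < Real.log t := Real.log_pos ht
  have hxa : 0 < x ^ (1 / α) := Real.rpow_pos_of_pos hx _
  rw [Real.mul_rpow hx.le (Real.rpow_nonneg hL.le _), ← Real.rpow_mul hL.le,
    mul_one_div_cancel hα.ne', Real.rpow_one, lt_div_iff₀ (by positivity), ← mul_assoc,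
    ← Real.rpow_add hx, neg_add_cancel, Real.rpow_zero, one_mul,
    Real.log_lt_log_iff (by linarith) hh]

theorem rpow_neg_one_div_lt_iff {α x s : ℝ} (hα : 0 < α) (hx : 0 < x) (hs : 0 < s) :
    x ^ (-(1 / α)) < s ↔ s ^ (-α) < x := by
  rw [← Real.rpow_lt_rpow_iff_of_neg hs (Real.rpow_pos_of_pos hx _) (neg_lt_zero.2 hα),
    ← Real.rpow_mul hx.le]
  rw [neg_mul_neg, one_div_mul_cancel hα.ne', Real.rpow_one]

/-- If a nondecreasing function exceeds `t` at `r`, its generalized inverse at `t` is at most `r`. -/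
theorem sSup_le_of_lt_of_monotoneOn {h : ℝ → ℝ} (hh : MonotoneOn h (Ici 0)) {r t : ℝ}
    (hr : 0 ≤ r) (ht : t < h r) : sSup {s : ℝ | 0 ≤ s ∧ h s ≤ t} ≤ r := by
  refine Real.sSup_le (fun s hs => ?_) hr
  by_contra! hlt
  exact (ht.trans_le (hh hr hs.1 hlt.le)).not_ge hs.2

/-- Let `α > 0` and let `H : [0,∞) × Ω → (0,∞)` be such that
`r ↦ H_r(ω)` is nondecreasing for each `ω`, each `H_r` is measurable, and for each
`t ≥ 0` the generalized inverse `M_t := sup{ r ≥ 0 : H_r ≤ t }` (with `sup ∅ := 0`,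
the convention of `sSup` on `ℝ`) is measurable and almost surely finite.  If
`(log H_r)/r^{1/α}` converges in distribution (tested against bounded continuous
functions) to a random variable `S` with `S > 0` a.s., then `M_t/(log t)^α` converges
in distribution to `S^{−α}` as `t → ∞`. -/
theorem generalized_inverse_asymptotics_in_law
    {Ω : Type*} [MeasurableSpace Ω] (P : Measure Ω) [IsProbabilityMeasure P]
    (α : ℝ) (hα : 0 < α)
    (H : ℝ → Ω → ℝ)
    (hpos : ∀ r : ℝ, 0 ≤ r → ∀ ω, 0 < H r ω)
    (hmono : ∀ ω, MonotoneOn (fun r => H r ω) (Ici (0:ℝ)))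
    (hmeas : ∀ r : ℝ, Measurable (H r))
    (M : ℝ → Ω → ℝ)
    (hM : ∀ t ω, M t ω = sSup {r : ℝ | 0 ≤ r ∧ H r ω ≤ t})
    (hMmeas : ∀ t : ℝ, Measurable (M t))
    (hMfin : ∀ t : ℝ, 0 ≤ t → ∀ᵐ ω ∂P, BddAbove {r : ℝ | 0 ≤ r ∧ H r ω ≤ t})
    (S : Ω → ℝ) (hSmeas : Measurable S) (hSpos : ∀ᵐ ω ∂P, 0 < S ω)
    (hconv : ∀ g : BoundedContinuousFunction ℝ ℝ,
      Tendsto (fun r : ℝ => ∫ ω, g (Real.log (H r ω) / r ^ (1/α)) ∂P) atTop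
        (𝓝 (∫ ω, g (S ω) ∂P))) :
    ∀ g : BoundedContinuousFunction ℝ ℝ,
      Tendsto (fun t : ℝ => ∫ ω, g (M t ω / Real.log t ^ α) ∂P) atTop
        (𝓝 (∫ ω, g (S ω ^ (-α)) ∂P)) := by
  have hYmeas : Measurable fun ω => S ω ^ (-α) := hSmeas.pow_const _
  have hXmeas (r : ℝ) : Measurable fun ω => Real.log (H r ω) / r ^ (1/α) :=
    (Real.measurable_log.comp (hmeas r)).div_const _
  have hVmeas (t : ℝ) : Measurable fun ω => M t ω / Real.log t ^ α := (hMmeas t).div_const _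
  have hM0 (t : ℝ) (ω : Ω) : 0 ≤ M t ω := by
    rw [hM]; exact Real.sSup_nonneg fun s hs => hs.1
  rw [← tendsto_law_iff_forall_integral hVmeas hYmeas]
  set D : Set ℝ := {x | x ≠ 0 ∧ P {ω | S ω ^ (-α) = x} = 0} with hDdef
  have hD : Dense D := by
    have hc : ({0} ∪ {x | 0 < P {ω | S ω ^ (-α) = x}}).Countable :=
      (countable_singleton _).union (Measure.countable_meas_level_set_pos hYmeas)
    refine (hc.dense_compl ℝ).mono fun x hx => ?_
    simpa [hDdef, not_or] using hx
  -- The tail of the rescaled process at the scale matching level `t`.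
  have htail (x : ℝ) (hx : 0 < x) (hxD : P {ω | S ω ^ (-α) = x} = 0) :
      Tendsto (fun t => P.real {ω | t < H (x * Real.log t ^ α) ω}) atTop
        (𝓝 (P.real {ω | S ω ^ (-α) ≤ x})) := by
    have hc : P {ω | S ω = x ^ (-(1 / α))} = 0 := by
      refine measure_mono_null (fun ω hω => ?_) hxD
      change S ω ^ (-α) = x
      change S ω = x ^ (-(1 / α)) at hω
      rw [hω, ← Real.rpow_mul hx.le, neg_mul_neg, one_div_mul_cancel hα.ne', Real.rpow_one]
    have hscale : Tendsto (fun t : ℝ => x * Real.log t ^ α) atTop atTop :=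
      ((tendsto_rpow_atTop hα).comp Real.tendsto_log_atTop).const_mul_atTop hx
    have hlim := (tendsto_measureReal_lt_of_forall_integral hXmeas hSmeas hconv hc).comp hscale
    have heq : P.real {ω | x ^ (-(1 / α)) < S ω} = P.real {ω | S ω ^ (-α) ≤ x} := by
      refine measureReal_congr ?_
      filter_upwards [hSpos, measure_eq_zero_iff_ae_notMem.1 hxD] with ω hω hne
      refine propext ?_
      change x ^ (-(1 / α)) < S ω ↔ S ω ^ (-α) ≤ x
      exact (rpow_neg_one_div_lt_iff hα hx hω).trans ⟨le_of_lt, fun h => lt_of_le_of_ne h hne⟩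
    rw [heq] at hlim
    refine hlim.congr' ?_
    filter_upwards [eventually_gt_atTop 1] with t ht
    refine congrArg P.real (ext fun ω => ?_)
    have hr : 0 ≤ x * Real.log t ^ α :=
      mul_nonneg hx.le (Real.rpow_nonneg (Real.log_pos ht).le _)
    exact rpow_neg_one_div_lt_log_div_iff hα hx ht (hpos _ hr ω)
  refine tendsto_probabilityMeasure_of_tendsto_Iic hD fun x hx => ?_
  have key {Z : Ω → ℝ} (hZ : Measurable Z) (y : ℝ) :
      (law P hZ : Measure ℝ).real (Iic y) = P.real {ω | Z ω ≤ y} :=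
    map_measureReal_apply hZ measurableSet_Iic
  simp only [key]
  rcases hx.1.lt_or_gt with hneg | hxpos
  · have h1 : P.real {ω | S ω ^ (-α) ≤ x} = 0 := by
      rw [measureReal_eq_zero_iff, measure_eq_zero_iff_ae_notMem]
      filter_upwards [hSpos] with ω hω
      exact (hneg.trans (Real.rpow_pos_of_pos hω _)).not_ge
    rw [h1]
    refine tendsto_const_nhds.congr' ?_
    filter_upwards [eventually_gt_atTop 1] with t ht
    rw [eq_comm, measureReal_eq_zero_iff]
    convert measure_empty (μ := P)
    refine eq_empty_of_forall_notMem fun ω => ?_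
    exact (hneg.trans_le (div_nonneg (hM0 t ω)
      (Real.rpow_nonneg (Real.log_pos ht).le _))).not_ge
  refine tendsto_order.2 ⟨fun a ha => ?_, fun a ha => ?_⟩
  · filter_upwards [(tendsto_order.1 (htail x hxpos hx.2)).1 a ha, eventually_gt_atTop 1]
      with t hat ht
    have hL : 0 < Real.log t ^ α := Real.rpow_pos_of_pos (Real.log_pos ht) _
    refine hat.trans_le (measureReal_mono fun ω hω => ?_)
    change M t ω / Real.log t ^ α ≤ x
    rw [div_le_iff₀ hL, hM]
    exact sSup_le_of_lt_of_monotoneOn (hmono ω) (by positivity) hω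
  · have hright : ∀ᶠ y in 𝓝[>] x, P.real {ω | S ω ^ (-α) ≤ y} < a := by
      have := Measure.isProbabilityMeasure_map (μ := P) hYmeas.aemeasurable
      have hF (y : ℝ) : ProbabilityTheory.cdf (P.map fun ω => S ω ^ (-α)) y =
          P.real {ω | S ω ^ (-α) ≤ y} :=
        (ProbabilityTheory.cdf_eq_real _ y).trans (key hYmeas y)
      have hcont := (ProbabilityTheory.cdf (P.map fun ω => S ω ^ (-α))).right_continuous x
      have hlim := (hcont.mono Ioi_subset_Ici_self).tendsto
      filter_upwards [(tendsto_order.1 hlim).2 a (by rwa [hF])] with y hy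
      rwa [← hF]
    obtain ⟨z, hxz, hz⟩ := (mem_nhdsGT_iff_exists_Ioo_subset (a := x)).1 hright
    obtain ⟨y, hyD, hy⟩ := hD.exists_between hxz
    have hy0 : 0 < y := hxpos.trans hy.1
    filter_upwards [(tendsto_order.1 (htail y hy0 hyD.2)).2 a (hz hy), eventually_gt_atTop 1]
      with t hat ht
    have hL : 0 < Real.log t ^ α := Real.rpow_pos_of_pos (Real.log_pos ht) _
    refine lt_of_le_of_lt (ENNReal.toReal_mono (measure_ne_top _ _) (measure_mono_ae ?_)) hat
    filter_upwards [hMfin t (by linarith)] with ω hbdd hω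
    change M t ω / Real.log t ^ α ≤ x at hω
    change t < H (y * Real.log t ^ α) ω
    by_contra! hle
    rw [div_le_iff₀ hL, hM] at hω
    have := (le_csSup hbdd ⟨by positivity, hle⟩).trans hω
    exact (mul_lt_mul_of_pos_right hy.1 hL).not_ge this
end

section
/- Let α > 0 and let (Ω, P) be a probability space. For each r > 0 let I_r and J_r be random variables with I_r > 0 and J_r ≥ 0 almost surely, and suppose there is a random variable C with C < ∞ almost surely and J_r ≤ C almost surely for every r. If (log I_r)/r^{1/α} converges in distribution, as r → ∞, to a random variable S with S ≥ 0 almost surely, then (log(I_r + J_r))/r^{1/α} also converges in distribution to S as r → ∞. -/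
open Set Filter Topology MeasureTheory

theorem MeasureTheory.tendstoInDistribution_iff_forall_integral_tendsto
    {ι Ω Ω' E : Type*} [MeasurableSpace Ω]
    [MeasurableSpace Ω'] [TopologicalSpace E] [MeasurableSpace E] [OpensMeasurableSpace E]
    {P : Measure Ω} [IsProbabilityMeasure P] {Q : Measure Ω'} [IsProbabilityMeasure Q]
    {l : Filter ι} {X : ι → Ω → E} {S : Ω' → E}
    (hX : ∀ i, AEMeasurable (X i) P) (hS : AEMeasurable S Q) :
    TendstoInDistribution X l S (fun _ ↦ P) Q ↔
      ∀ g : BoundedContinuousFunction E ℝ,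
        Tendsto (fun i ↦ ∫ ω, g (X i ω) ∂P) l (𝓝 (∫ ω, g (S ω) ∂Q)) := by
  have key (g : BoundedContinuousFunction E ℝ) :
      (∫ x, g x ∂(Q.map S) = ∫ ω, g (S ω) ∂Q) ∧
        ∀ i, ∫ x, g x ∂(P.map (X i)) = ∫ ω, g (X i ω) ∂P :=
    ⟨integral_map hS g.continuous.measurable.aestronglyMeasurable,
      fun i ↦ integral_map (hX i) g.continuous.measurable.aestronglyMeasurable⟩
  constructor
  · intro h g
    have := ProbabilityMeasure.tendsto_iff_forall_integral_tendsto.1 h.tendsto g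
    simpa [(key g).1, (key g).2] using this
  · intro h
    refine ⟨hX, hS, ProbabilityMeasure.tendsto_iff_forall_integral_tendsto.2 fun g ↦ ?_⟩
    simpa [(key g).1, (key g).2] using h g

/-- The bounded continuous function `x ↦ min x⁻ 1`. -/
noncomputable def truncatedNegPart : BoundedContinuousFunction ℝ ℝ :=
  BoundedContinuousFunction.ofNormedAddCommGroup (fun x ↦ min (max (-x) 0) 1) (by fun_prop) 1
    fun x ↦ by
      rw [Real.norm_of_nonneg (le_min (le_max_right _ _) zero_le_one)]
      exact min_le_right _ _

theorem truncatedNegPart_apply (x : ℝ) : truncatedNegPart x = min (max (-x) 0) 1 := rfl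

/-- Convergence in distribution to a nonnegative limit is preserved when `X i` is replaced by
some `Y i` between `X i` and `(X i)⁺ + a i * D` with `a i → 0`. -/
theorem MeasureTheory.TendstoInDistribution.of_le_of_le_max_add {ι Ω : Type*} [MeasurableSpace Ω]
    {P : Measure Ω} [IsProbabilityMeasure P] {l : Filter ι} [l.IsCountablyGenerated]
    {X Y : ι → Ω → ℝ} {S D : Ω → ℝ} {a : ι → ℝ}
    (hXS : TendstoInDistribution X l S (fun _ ↦ P) P) (hS : ∀ᵐ ω ∂P, 0 ≤ S ω)
    (hY : ∀ i, AEMeasurable (Y i) P) (hD : AEMeasurable D P) (hD0 : ∀ ω, 0 ≤ D ω)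
    (ha0 : ∀ i, 0 ≤ a i) (ha : Tendsto a l (𝓝 0))
    (hXY : ∀ i, ∀ᵐ ω ∂P, X i ω ≤ Y i ω)
    (hYX : ∀ i, ∀ᵐ ω ∂P, Y i ω ≤ max (X i ω) 0 + a i * D ω) :
    TendstoInDistribution Y l S (fun _ ↦ P) P := by
  have hX := hXS.forall_aemeasurable
  refine tendstoInDistribution_of_tendstoInMeasure_sub Y S hXS ?_ hY
  rw [tendstoInMeasure_iff_measureReal_norm]
  intro ε hε
  have h_neg : Tendsto (fun i ↦ ∫ ω, truncatedNegPart (X i ω) ∂P) l (𝓝 0) := by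
    have h := (tendstoInDistribution_iff_forall_integral_tendsto hX hXS.aemeasurable_limit).1 hXS
      truncatedNegPart
    rwa [integral_eq_zero_of_ae (by
      filter_upwards [hS] with ω hω
      simp [truncatedNegPart_apply, hω])] at h
  have h_meas (i : ι) : AEStronglyMeasurable (fun ω ↦ min (a i * D ω) 1) P :=
    ((hD.const_mul (a i)).min aemeasurable_const).aestronglyMeasurable
  have h_nonneg (i : ι) (ω : Ω) : 0 ≤ min (a i * D ω) 1 :=
    le_min (mul_nonneg (ha0 i) (hD0 ω)) zero_le_one
  have h_bound (i : ι) (ω : Ω) : ‖min (a i * D ω) 1‖ ≤ 1 := by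
    rw [Real.norm_of_nonneg (h_nonneg i ω)]
    exact min_le_right _ _
  have h_err : Tendsto (fun i ↦ ∫ ω, min (a i * D ω) 1 ∂P) l (𝓝 0) := by
    have h := tendsto_integral_filter_of_dominated_convergence (μ := P) (l := l)
      (F := fun i ω ↦ min (a i * D ω) 1) (f := fun _ ↦ 0) (fun _ ↦ 1)
      (.of_forall h_meas) (.of_forall fun i ↦ .of_forall (h_bound i)) (integrable_const _)
      (.of_forall fun ω ↦ by simpa using (ha.mul_const (D ω)).min (tendsto_const_nhds (x := 1)))
    simpa using h
  have h_neg_int (i : ι) : Integrable (fun ω ↦ truncatedNegPart (X i ω)) P :=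
    .of_bound (truncatedNegPart.continuous.measurable.comp_aemeasurable
      (hX i)).aestronglyMeasurable ‖truncatedNegPart‖
      (.of_forall fun ω ↦ truncatedNegPart.norm_coe_le_norm _)
  have h_err_int (i : ι) : Integrable (fun ω ↦ min (a i * D ω) 1) P :=
    .of_bound (h_meas i) 1 (.of_forall (h_bound i))
  set δ := min ε 1
  have hδ : 0 < δ := lt_min hε zero_lt_one
  refine squeeze_zero (fun _ ↦ measureReal_nonneg) (fun i ↦ ?_)
    (by simpa using (h_neg.add h_err).div_const δ)
  rw [le_div_iff₀' hδ, ← integral_add (h_neg_int i) (h_err_int i)]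
  refine le_trans ?_ (mul_meas_ge_le_integral_of_nonneg (.of_forall fun ω ↦ ?_)
    ((h_neg_int i).add (h_err_int i)) δ)
  · refine mul_le_mul_of_nonneg_left (ENNReal.toReal_mono (measure_ne_top _ _)
      (measure_mono_ae ?_)) hδ.le
    filter_upwards [hXY i, hYX i] with ω h1 h2 h3
    have h3 : ε ≤ ‖Y i ω - X i ω‖ := by simpa using! h3
    rw [Real.norm_of_nonneg (sub_nonneg.2 h1)] at h3
    change min ε 1 ≤ min (max (-X i ω) 0) 1 + min (a i * D ω) 1
    have := mul_nonneg (ha0 i) (hD0 ω)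
    grind
  · exact add_nonneg (le_min (le_max_right _ _) zero_le_one) (h_nonneg i ω)

theorem Real.log_add_le_max_log_add_log {x y c : ℝ} (hx : 0 < x) (hy : 0 ≤ y) (hyc : y ≤ c) :
    Real.log (x + y) ≤ max (Real.log x) 0 + Real.log (1 + c) := by
  have hc : 0 < 1 + c := by linarith
  rcases le_total x 1 with h | h
  · have := Real.log_le_log (by linarith) (show x + y ≤ 1 + c by linarith)
    linarith [le_max_right (Real.log x) 0]
  · have := Real.log_le_log (by linarith) (show x + y ≤ x * (1 + c) by nlinarith)
    rw [Real.log_mul hx.ne' hc.ne'] at this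
    linarith [le_max_left (Real.log x) 0]

/-- Let `α > 0`.  For each `r > 0` let `I_r` and `J_r` be random
variables with `I_r > 0` and `J_r ≥ 0` a.s., and suppose `J_r ≤ C` a.s. for every `r`,
for a single (finite, real-valued) random variable `C`.  If `(log I_r)/r^{1/α}` converges
in distribution (tested against bounded continuous functions) to a random variable `S`
with `S ≥ 0` a.s., then `(log(I_r + J_r))/r^{1/α}` also converges in distribution to
`S`. -/
theorem log_convergence_stable_under_bounded_perturbation
    {Ω : Type*} [MeasurableSpace Ω] (P : Measure Ω) [IsProbabilityMeasure P]
    (α : ℝ) (hα : 0 < α)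
    (I J : ℝ → Ω → ℝ) (C : Ω → ℝ)
    (hImeas : ∀ r : ℝ, 0 < r → Measurable (I r))
    (hJmeas : ∀ r : ℝ, 0 < r → Measurable (J r))
    (hCmeas : Measurable C)
    (hIpos : ∀ r : ℝ, 0 < r → ∀ᵐ ω ∂P, 0 < I r ω)
    (hJnonneg : ∀ r : ℝ, 0 < r → ∀ᵐ ω ∂P, 0 ≤ J r ω)
    (hJC : ∀ r : ℝ, 0 < r → ∀ᵐ ω ∂P, J r ω ≤ C ω)
    (S : Ω → ℝ) (hSmeas : Measurable S) (hSnonneg : ∀ᵐ ω ∂P, 0 ≤ S ω)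
    (hconv : ∀ g : BoundedContinuousFunction ℝ ℝ,
      Tendsto (fun r : ℝ => ∫ ω, g (Real.log (I r ω) / r ^ (1/α)) ∂P) atTop
        (𝓝 (∫ ω, g (S ω) ∂P))) :
    ∀ g : BoundedContinuousFunction ℝ ℝ,
      Tendsto (fun r : ℝ => ∫ ω, g (Real.log (I r ω + J r ω) / r ^ (1/α)) ∂P) atTop
        (𝓝 (∫ ω, g (S ω) ∂P)) := by
  let l : Filter (Ioi (0 : ℝ)) := comap Subtype.val atTop
  have hl {E : Type} (f : ℝ → E) (m : Filter E) :
      Tendsto (fun r : Ioi (0 : ℝ) ↦ f r) l m ↔ Tendsto f atTop m := by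
    rw [← tendsto_comp_val_Ioi_atTop (a := (0 : ℝ)), atTop_Ioi_eq]
  have hXmeas (r : Ioi (0 : ℝ)) :
      AEMeasurable (fun ω ↦ Real.log (I r ω) / (r : ℝ) ^ (1 / α)) P :=
    ((hImeas r r.2).log.div_const _).aemeasurable
  have hYmeas (r : Ioi (0 : ℝ)) :
      AEMeasurable (fun ω ↦ Real.log (I r ω + J r ω) / (r : ℝ) ^ (1 / α)) P :=
    (((hImeas r r.2).add (hJmeas r r.2)).log.div_const _).aemeasurable
  have hpow (r : Ioi (0 : ℝ)) : 0 < (r : ℝ) ^ (1 / α) := Real.rpow_pos_of_pos r.2 _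
  have hXS := (tendstoInDistribution_iff_forall_integral_tendsto (l := l) hXmeas
    hSmeas.aemeasurable).2 fun g ↦
      (hl (fun r ↦ ∫ ω, g (Real.log (I r ω) / r ^ (1 / α)) ∂P) _).2 (hconv g)
  have hYS := hXS.of_le_of_le_max_add hSnonneg hYmeas (D := fun ω ↦ Real.log (1 + |C ω|))
    (a := fun r : Ioi (0 : ℝ) ↦ ((r : ℝ) ^ (1 / α))⁻¹) (by fun_prop)
    (fun ω ↦ Real.log_nonneg (by linarith [abs_nonneg (C ω)]))
    (fun r ↦ (inv_pos.2 (hpow r)).le)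
    ((hl (fun r ↦ (r ^ (1 / α))⁻¹) _).2 (tendsto_rpow_atTop (by positivity)).inv_tendsto_atTop)
    (fun r ↦ by
      filter_upwards [hIpos r r.2, hJnonneg r r.2] with ω hI hJ
      exact div_le_div_of_nonneg_right (Real.log_le_log hI (by linarith)) (hpow r).le)
    (fun r ↦ by
      filter_upwards [hIpos r r.2, hJnonneg r r.2, hJC r r.2] with ω hI hJ hC
      have h := Real.log_add_le_max_log_add_log hI hJ (hC.trans (le_abs_self _))
      calc Real.log (I r ω + J r ω) / (r : ℝ) ^ (1 / α)
        _ ≤ (max (Real.log (I r ω)) 0 + Real.log (1 + |C ω|)) / (r : ℝ) ^ (1 / α) :=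
          div_le_div_of_nonneg_right h (hpow r).le
        _ = _ := by
          rw [add_div, ← max_div_div_right (hpow r).le, zero_div,
            div_eq_inv_mul (Real.log (1 + _))])
  intro g
  exact (hl (fun r ↦ ∫ ω, g (Real.log (I r ω + J r ω) / r ^ (1 / α)) ∂P) _).1
    ((tendstoInDistribution_iff_forall_integral_tendsto hYmeas hSmeas.aemeasurable).1 hYS g)
end

section
/- Let f : [0,∞) → ℝ be càdlàg and define γ₀ := 0 and γ_{k+1} := inf{ t > γ_k : |f(t) − f(γ_k)| ≥ 1 } (with inf ∅ := +∞). Then for every r > 0 the set { k : γ_k ≤ r } is finite, say with maximal element K, and the largest ascending barrier of f on [0,r] satisfies sup{ f(y) − f(x) : 0 ≤ x ≤ y ≤ r } ≤ max{ f(γ_k) − f(γ_j) : 0 ≤ j ≤ k ≤ K } + 2. -/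
open Set Filter Topology
open scoped ENNReal

/-- Given `f : [0,∞) → ℝ`, the sequence of crossing times `γ₀ := 0`,
`γ_{k+1} := inf{ t > γ_k : |f(t) − f(γ_k)| ≥ 1 }`, with the convention `inf ∅ := +∞`
(values are taken in `ℝ≥0∞`; `sInf ∅ = ⊤` there). -/
noncomputable def gammaSeq (f : ℝ → ℝ) : ℕ → ℝ≥0∞
  | 0 => 0
  | k + 1 => sInf (ENNReal.ofReal ''
      {t : ℝ | gammaSeq f k < ENNReal.ofReal t ∧ 1 ≤ |f t - f (gammaSeq f k).toReal|})

theorem gammaSeq_mono (f : ℝ → ℝ) : Monotone (gammaSeq f) := by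
  refine monotone_nat_of_le_succ fun k => ?_
  rw [gammaSeq]
  refine le_sInf ?_
  rintro _ ⟨t, ht, rfl⟩
  exact ht.1.le

theorem abs_sub_gammaSeq_lt_one (f : ℝ → ℝ) {k : ℕ} {t : ℝ} (ht : 0 ≤ t)
    (h₁ : gammaSeq f k ≤ ENNReal.ofReal t) (h₂ : ENNReal.ofReal t < gammaSeq f (k + 1)) :
    |f t - f (gammaSeq f k).toReal| < 1 := by
  rcases h₁.eq_or_lt with h | h
  · simp [h, ENNReal.toReal_ofReal ht]
  · by_contra! hc
    rw [gammaSeq] at h₂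
    exact notMem_of_lt_csInf h₂ (OrderBot.bddBelow _) ⟨t, ⟨h, hc⟩, rfl⟩

theorem one_le_abs_sub_gammaSeq_succ {f : ℝ → ℝ}
    (hrc : ∀ x : ℝ, 0 ≤ x → Tendsto f (𝓝[≥] x) (𝓝 (f x))) {k : ℕ}
    (hk : gammaSeq f (k + 1) ≠ ⊤) :
    1 ≤ |f (gammaSeq f (k + 1)).toReal - f (gammaSeq f k).toReal| := by
  by_contra! hlt
  have hev := (((hrc _ ENNReal.toReal_nonneg).sub_const (f (gammaSeq f k).toReal)).abs).eventually
    (gt_mem_nhds hlt)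
  obtain ⟨u, hu, hsub⟩ := mem_nhdsGE_iff_exists_Ico_subset.1 hev
  have hlt_u : gammaSeq f (k + 1) < ENNReal.ofReal u :=
    (ENNReal.lt_ofReal_iff_toReal_lt hk).2 hu
  have hlt_u' := hlt_u
  rw [gammaSeq, sInf_lt_iff] at hlt_u'
  obtain ⟨_, ⟨t, ht, rfl⟩, htu⟩ := hlt_u'
  have hge : gammaSeq f (k + 1) ≤ ENNReal.ofReal t := by
    rw [gammaSeq]
    exact sInf_le ⟨t, ht, rfl⟩
  have ht0 : 0 < t := ENNReal.ofReal_pos.1 (bot_le.trans_lt ht.1)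
  have hmem := hsub ⟨ENNReal.toReal_le_of_le_ofReal ht0.le hge,
    (ENNReal.ofReal_lt_ofReal_iff_of_nonneg ht0.le).1 htu⟩
  exact absurd ht.2 (not_le.2 hmem)

theorem gammaSeq_lt_succ {f : ℝ → ℝ}
    (hrc : ∀ x : ℝ, 0 ≤ x → Tendsto f (𝓝[≥] x) (𝓝 (f x))) {k : ℕ}
    (hk : gammaSeq f k ≠ ⊤) : gammaSeq f k < gammaSeq f (k + 1) := by
  refine (gammaSeq_mono f k.le_succ).lt_of_ne fun h => ?_
  have := one_le_abs_sub_gammaSeq_succ hrc (h ▸ hk)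
  rw [← h, sub_self, abs_zero] at this
  linarith

/-- The crossing times of a càdlàg function do not accumulate. -/
theorem finite_setOf_gammaSeq_le {f : ℝ → ℝ}
    (hrc : ∀ x : ℝ, 0 ≤ x → Tendsto f (𝓝[≥] x) (𝓝 (f x)))
    (hll : ∀ s : ℝ, 0 < s → ∃ L : ℝ, Tendsto f (𝓝[Ico 0 s] s) (𝓝 L)) (r : ℝ) :
    {k : ℕ | gammaSeq f k ≤ ENNReal.ofReal r}.Finite := by
  by_contra hinf
  have hle : ∀ k, gammaSeq f k ≤ ENNReal.ofReal r := fun k => by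
    obtain ⟨n, hn, hkn⟩ := Set.Infinite.exists_gt hinf k
    exact (gammaSeq_mono f hkn.le).trans hn
  have hne : ∀ k, gammaSeq f k ≠ ⊤ := fun k => ne_top_of_le_ne_top ENNReal.ofReal_ne_top (hle k)
  have hmono : StrictMono fun k => (gammaSeq f k).toReal :=
    strictMono_nat_of_lt_succ fun k =>
      (ENNReal.toReal_lt_toReal (hne k) (hne _)).2 (gammaSeq_lt_succ hrc (hne k))
  have hbdd : BddAbove (range fun k => (gammaSeq f k).toReal) := by
    refine ⟨(ENNReal.ofReal r).toReal, ?_⟩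
    rintro _ ⟨k, rfl⟩
    exact ENNReal.toReal_mono ENNReal.ofReal_ne_top (hle k)
  have hlim := tendsto_atTop_ciSup hmono.monotone hbdd
  set s := ⨆ k, (gammaSeq f k).toReal
  have hlt : ∀ k, (gammaSeq f k).toReal < s := fun k =>
    (hmono k.lt_succ_self).trans_le (le_ciSup hbdd (k + 1))
  obtain ⟨L, hL⟩ := hll s (ENNReal.toReal_nonneg.trans_lt (hlt 0))
  have hfL : Tendsto (fun k => f (gammaSeq f k).toReal) atTop (𝓝 L) :=
    hL.comp (tendsto_nhdsWithin_iff.2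
      ⟨hlim, Eventually.of_forall fun k => ⟨ENNReal.toReal_nonneg, hlt k⟩⟩)
  have hdiff := (((tendsto_add_atTop_iff_nat 1).2 hfL).sub hfL).abs
  have : (1 : ℝ) ≤ |L - L| :=
    ge_of_tendsto' hdiff fun k => one_le_abs_sub_gammaSeq_succ hrc (hne _)
  norm_num at this

/-- For a càdlàg `f : [0,∞) → ℝ` (right-continuous at each `x ≥ 0`,
with a left limit at each `s > 0`) and every `r > 0`, the set `{ k : γ_k ≤ r }` is
finite, and if `K` is its maximal element then the largest ascending barrier of `f` on
`[0,r]` is at most `max{ f(γ_k) − f(γ_j) : 0 ≤ j ≤ k ≤ K } + 2`. -/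
theorem barrier_le_crossing_max_add_two
    (f : ℝ → ℝ)
    (hrc : ∀ x : ℝ, 0 ≤ x → Tendsto f (𝓝[≥] x) (𝓝 (f x)))
    (hll : ∀ s : ℝ, 0 < s → ∃ L : ℝ, Tendsto f (𝓝[Ico 0 s] s) (𝓝 L))
    (r : ℝ) (hr : 0 < r) :
    {k : ℕ | gammaSeq f k ≤ ENNReal.ofReal r}.Finite ∧
    ∀ K : ℕ, IsGreatest {k : ℕ | gammaSeq f k ≤ ENNReal.ofReal r} K →
      sSup {d : ℝ | ∃ x y : ℝ, 0 ≤ x ∧ x ≤ y ∧ y ≤ r ∧ d = f y - f x}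
        ≤ sSup {d : ℝ | ∃ j k : ℕ, j ≤ k ∧ k ≤ K ∧
            d = f (gammaSeq f k).toReal - f (gammaSeq f j).toReal} + 2 := by
  have hfin := finite_setOf_gammaSeq_le hrc hll r
  refine ⟨hfin, fun K hK => ?_⟩
  have hloc : ∀ x, 0 ≤ x → x ≤ r → ∃ k, IsGreatest {k | gammaSeq f k ≤ ENNReal.ofReal x} k ∧
      |f x - f (gammaSeq f k).toReal| < 1 := fun x hx hxr => by
    obtain ⟨k, hk⟩ := (finite_setOf_gammaSeq_le hrc hll x).exists_maximal
      ⟨0, by simp [gammaSeq]⟩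
    have hk' : IsGreatest {k | gammaSeq f k ≤ ENNReal.ofReal x} k := maximal_iff_isGreatest.1 hk
    refine ⟨k, hk', abs_sub_gammaSeq_lt_one f hx hk'.1 ?_⟩
    by_contra! h
    exact absurd (hk'.2 h) (by omega)
  have hbdd : BddAbove {d : ℝ | ∃ j k : ℕ, j ≤ k ∧ k ≤ K ∧
      d = f (gammaSeq f k).toReal - f (gammaSeq f j).toReal} := by
    refine (((finite_Iic K).prod (finite_Iic K)).image fun p : ℕ × ℕ =>
      f (gammaSeq f p.2).toReal - f (gammaSeq f p.1).toReal).bddAbove.mono ?_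
    rintro _ ⟨j, k, hjk, hkK, rfl⟩
    exact ⟨(j, k), ⟨hjk.trans hkK, hkK⟩, rfl⟩
  refine csSup_le ⟨0, 0, 0, le_rfl, le_rfl, hr.le, by simp⟩ ?_
  rintro _ ⟨x, y, hx, hxy, hyr, rfl⟩
  obtain ⟨j, hj, hxj⟩ := hloc x hx (hxy.trans hyr)
  obtain ⟨k, hk, hyk⟩ := hloc y (hx.trans hxy) hyr
  have hjk : j ≤ k := hk.2 (hj.1.trans (ENNReal.ofReal_le_ofReal hxy))
  have hkK : k ≤ K := hK.2 (hk.1.trans (ENNReal.ofReal_le_ofReal hyr))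
  have := le_csSup hbdd ⟨j, k, hjk, hkK, rfl⟩
  linarith [(abs_lt.1 hxj).1, (abs_lt.1 hyk).2]
end

section
/- Let r > 0 and let f : [0,r] → ℝ be bounded and measurable, and set A(x) := ∫₀^x e^{f(y)} dy for x ∈ [0,r]. Then A(r) − A(y) > 0 for every y ∈ [0,r), the function y ↦ log( A(r) / (A(r) − A(y)) ) is integrable on [0,r), and ∫₀^r log( A(r) / (A(r) − A(y)) ) dy ≤ r ( sup_{[0,r]} f − inf_{[0,r]} f + 1 + log 8 ). -/
open Set Filter Topology MeasureTheory

/-- Let `r > 0` and let `f : [0,r] → ℝ` be bounded and measurable, and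
set `A(x) := ∫₀^x e^{f(y)} dy`.  Then `A(r) − A(y) > 0` for `y ∈ [0,r)`, the function
`y ↦ log(A(r)/(A(r) − A(y)))` is integrable on `[0,r)`, and its integral is at most
`r (sup_{[0,r]} f − inf_{[0,r]} f + 1 + log 8)`. -/
theorem log_scale_ratio_integral_bound
    (r : ℝ) (hr : 0 < r)
    (f : ℝ → ℝ) (hmeas : Measurable f)
    (hbdd : ∃ M : ℝ, ∀ y ∈ Icc (0:ℝ) r, |f y| ≤ M)
    (A : ℝ → ℝ) (hA : ∀ x, A x = ∫ y in (0:ℝ)..x, Real.exp (f y)) :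
    (∀ y ∈ Ico (0:ℝ) r, 0 < A r - A y) ∧
    IntegrableOn (fun y => Real.log (A r / (A r - A y))) (Ico (0:ℝ) r) volume ∧
    ∫ y in Ico (0:ℝ) r, Real.log (A r / (A r - A y))
      ≤ r * (sSup (f '' Icc (0:ℝ) r) - sInf (f '' Icc (0:ℝ) r) + 1 + Real.log 8) := by
  obtain ⟨M, hM⟩ := hbdd
  set S := sSup (f '' Icc (0:ℝ) r)
  set I := sInf (f '' Icc (0:ℝ) r)
  have hS : ∀ y ∈ Icc (0:ℝ) r, f y ≤ S := fun y hy =>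
    le_csSup ⟨M, by rintro _ ⟨z, hz, rfl⟩; exact (abs_le.1 (hM z hz)).2⟩ (mem_image_of_mem f hy)
  have hI : ∀ y ∈ Icc (0:ℝ) r, I ≤ f y := fun y hy =>
    csInf_le ⟨-M, by rintro _ ⟨z, hz, rfl⟩; exact (abs_le.1 (hM z hz)).1⟩ (mem_image_of_mem f hy)
  have hint : IntegrableOn (fun y => Real.exp (f y)) (Icc 0 r) := by
    refine Measure.integrableOn_of_bounded (M := Real.exp S) (by simp)
      hmeas.exp.aestronglyMeasurable ?_
    filter_upwards [ae_restrict_mem measurableSet_Icc] with y hy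
    rw [Real.norm_of_nonneg (Real.exp_pos _).le]
    exact Real.exp_le_exp.2 (hS y hy)
  have hii : ∀ a b, 0 ≤ a → a ≤ b → b ≤ r →
      IntervalIntegrable (fun y => Real.exp (f y)) volume a b := fun a b ha hab hb =>
    (intervalIntegrable_iff_integrableOn_Icc_of_le hab).2 (hint.mono_set (Icc_subset_Icc ha hb))
  have hsub : ∀ y ∈ Icc (0:ℝ) r, A r - A y = ∫ z in y..r, Real.exp (f z) := fun y hy => by
    rw [hA, hA, intervalIntegral.integral_interval_sub_left
      (hii 0 r le_rfl hr.le le_rfl) (hii 0 y le_rfl hy.1 hy.2)]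
  have hlow : ∀ y ∈ Icc (0:ℝ) r, (r - y) * Real.exp I ≤ A r - A y := fun y hy => by
    rw [hsub y hy, ← smul_eq_mul, ← intervalIntegral.integral_const]
    exact intervalIntegral.integral_mono_on hy.2 (by simp) (hii y r hy.1 hy.2 le_rfl)
      fun z hz => Real.exp_le_exp.2 (hI z ⟨hy.1.trans hz.1, hz.2⟩)
  have hup : A r ≤ r * Real.exp S := by
    have h : ∫ z in (0:ℝ)..r, Real.exp (f z) ≤ ∫ _ in (0:ℝ)..r, Real.exp S :=
      intervalIntegral.integral_mono_on hr.le (hii 0 r le_rfl hr.le le_rfl) (by simp)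
        fun z hz => Real.exp_le_exp.2 (hS z hz)
    simpa [hA] using h
  have hpos : ∀ y ∈ Ico (0:ℝ) r, 0 < A r - A y := fun y hy =>
    (mul_pos (sub_pos.2 hy.2) (Real.exp_pos I)).trans_le (hlow y ⟨hy.1, hy.2.le⟩)
  have hA0 : A 0 = 0 := by simp [hA]
  have hAr : 0 < A r := by simpa [hA0] using hpos 0 ⟨le_rfl, hr⟩
  have hAnn : ∀ y ∈ Icc (0:ℝ) r, 0 ≤ A y := fun y hy => by
    rw [hA]
    exact intervalIntegral.integral_nonneg hy.1 fun z _ => (Real.exp_pos _).le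
  have hcont : ContinuousOn A (Icc 0 r) := by
    have h := intervalIntegral.continuousOn_primitive_interval
      (f := fun y => Real.exp (f y)) (μ := volume) (a := 0) (b := r) (by rwa [uIcc_of_le hr.le])
    rw [uIcc_of_le hr.le] at h
    exact h.congr fun x _ => hA x
  have hcont' : ContinuousOn (fun y => Real.log (A r / (A r - A y))) (Ico 0 r) := by
    refine ContinuousOn.log (continuousOn_const.div
      (continuousOn_const.sub (hcont.mono Ico_subset_Icc_self)) fun y hy => (hpos y hy).ne') ?_
    exact fun y hy => (div_pos hAr (hpos y hy)).ne'
  have hle : ∀ y ∈ Ico (0:ℝ) r,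
      Real.log (A r / (A r - A y)) ≤ (S - I + Real.log r) - Real.log (r - y) := fun y hy => by
    have hy' : 0 < r - y := sub_pos.2 hy.2
    have h1 := Real.log_le_log hAr hup
    have h2 := Real.log_le_log (mul_pos hy' (Real.exp_pos I)) (hlow y ⟨hy.1, hy.2.le⟩)
    rw [Real.log_mul hr.ne' (Real.exp_ne_zero _), Real.log_exp] at h1
    rw [Real.log_mul hy'.ne' (Real.exp_ne_zero _), Real.log_exp] at h2
    rw [Real.log_div hAr.ne' (hpos y hy).ne']
    linarith
  have hnn : ∀ y ∈ Ico (0:ℝ) r, 0 ≤ Real.log (A r / (A r - A y)) := fun y hy =>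
    Real.log_nonneg ((one_le_div (hpos y hy)).2 (by linarith [hAnn y ⟨hy.1, hy.2.le⟩]))
  have hlog : IntervalIntegrable (fun y => Real.log (r - y)) volume 0 r := by
    have h := (intervalIntegral.intervalIntegrable_log' (a := r) (b := 0)).comp_sub_left r
    simpa using h
  have hgi : IntervalIntegrable
      (fun y => (S - I + Real.log r) - Real.log (r - y)) volume 0 r :=
    intervalIntegrable_const.sub hlog
  have hg : IntegrableOn (fun y => (S - I + Real.log r) - Real.log (r - y)) (Ico 0 r) :=
    (intervalIntegrable_iff_integrableOn_Ico_of_le hr.le).1 hgi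
  have hF : IntegrableOn (fun y => Real.log (A r / (A r - A y))) (Ico (0:ℝ) r) := by
    refine Integrable.mono' hg (hcont'.aestronglyMeasurable measurableSet_Ico) ?_
    filter_upwards [ae_restrict_mem measurableSet_Ico] with y hy
    rw [Real.norm_of_nonneg (hnn y hy)]
    exact hle y hy
  refine ⟨hpos, hF, (setIntegral_mono_on hF hg measurableSet_Ico hle).trans ?_⟩
  have hval : ∫ y in Ico (0:ℝ) r, ((S - I + Real.log r) - Real.log (r - y)) = r * (S - I + 1) := by
    rw [integral_Ico_eq_integral_Ioc, ← intervalIntegral.integral_of_le hr.le,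
      intervalIntegral.integral_sub intervalIntegrable_const hlog,
      intervalIntegral.integral_comp_sub_left (fun y => Real.log y) r]
    simp
    ring
  rw [hval]
  have h8 : 0 ≤ Real.log 8 := Real.log_nonneg (by norm_num)
  exact mul_le_mul_of_nonneg_left (by linarith) hr.le
end
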